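/- arXiv:2104.00856 — 3 statements merged into one kernel-verified Lean document; each statement's English description precedes it below -/
import Mathlib

section
/- There exist an absolute constant C > 0 and, for every ε > 0, a constant C_ε > 0 such that: for every N ≥ 2, θ ∈ (0,1], and every N^{1/2}-short generalized Dirichlet sequence {a_n}_{n=1}^{N^{1/2}} with parameters (N,θ), the number of 6-tuples (n₁,…,n₆) of integers in [1, N^{1/2}] satisfying |(a_{n₁} + a_{n₂} + a_{n₃}) − (a_{n₄} + a_{n₅} + a_{n₆})| ≤ θ/N² is at most C_ε (log(θ^{-1}+1))^C N^{3/2+ε}. -/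
/-- `{a_n}_{n=1}^{R}` is an `N^{1/2}`-short generalized Dirichlet sequence with
parameters `(N, θ)`. -/
def ShortGDS (N : ℝ) (R : ℕ) (θ : ℝ) (a : ℕ → ℝ) : Prop :=
  a 2 - a 1 ∈ Set.Icc (1 / (4 * N)) (4 / N) ∧
  ∀ i : ℕ, 1 ≤ i → i + 2 ≤ R →
    (a (i + 2) - a (i + 1)) - (a (i + 1) - a i) ∈
      Set.Icc (θ / (4 * N ^ 2)) (4 * θ / N ^ 2)

namespace ShortDirichlet

open Finset ComplexConjugate

/-- A real sequence all of whose second differences lie in `[1/4, 4]`. -/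
def IsConvexSeq (f : ℕ → ℝ) : Prop :=
  ∀ n, f (n + 2) - f (n + 1) - (f (n + 1) - f n) ∈ Set.Icc (1 / 4 : ℝ) 4

/-- Functions `e n` of modulus at most one on a finite space such that six-fold correlations
vanish away from the approximate additive sextuples of `n ↦ (n, f n)`. -/
structure IsSystem {T : Type} [Fintype T] (f : ℕ → ℝ) (e : ℕ → T → ℂ) : Prop where
  convex : IsConvexSeq f
  norm_le : ∀ n x, ‖e n x‖ ≤ 1
  orth : ∀ n₁ n₂ n₃ n₄ n₅ n₆,
    ∑ x, e n₁ x * e n₂ x * e n₃ x * conj (e n₄ x) * conj (e n₅ x) * conj (e n₆ x) ≠ 0 →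
      n₁ + n₂ + n₃ = n₄ + n₅ + n₆ ∧ |f n₁ + f n₂ + f n₃ - (f n₄ + f n₅ + f n₆)| ≤ 3

/-- The exponential sum over `A`. -/
def expSum {T : Type} (e : ℕ → T → ℂ) (A : Finset ℕ) (x : T) : ℂ := ∑ n ∈ A, e n x

/-- `A` lies in an interval of `L` consecutive integers. -/
def IsWindow (L : ℕ) (A : Finset ℕ) : Prop := ∃ u, A ⊆ Ico u (u + L)

/-- `A` and `B` lie on different sides of a gap of length `D`. -/
def Separated (D : ℕ) (A B : Finset ℕ) : Prop :=
  (∀ a ∈ A, ∀ b ∈ B, a + D ≤ b) ∨ (∀ a ∈ A, ∀ b ∈ B, b + D ≤ a)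

/-- Sixth moments over windows of length `L` are at most `G * L ^ lam`. -/
def MomentBound {T : Type} [Fintype T] (e : ℕ → T → ℂ) (G lam : ℝ) : Prop :=
  ∀ (L : ℕ) (A : Finset ℕ), 1 ≤ L → IsWindow L A →
    ∑ x, ‖expSum e A x‖ ^ 6 ≤ G * (L : ℝ) ^ lam

/-! ### Convex sequences -/

lemma IsConvexSeq.slope {f : ℕ → ℝ} (hf : IsConvexSeq f) (m k : ℕ) :
    (f (m + k + 1) - f (m + k)) - (f (m + 1) - f m) ∈ Set.Icc ((k : ℝ) / 4) (4 * k) := by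
  induction k with
  | zero => simp
  | succ k ih =>
    have h := hf (m + k)
    simp only [Set.mem_Icc] at h ih ⊢
    push_cast
    rw [show m + (k + 1) + 1 = m + k + 2 by ring, show m + (k + 1) = m + k + 1 by ring]
    constructor <;> linarith [h.1, h.2, ih.1, ih.2]

lemma IsConvexSeq.tangent {f : ℕ → ℝ} (hf : IsConvexSeq f) (v k : ℕ) :
    f (v + k) - f v - k * (f (v + 1) - f v) ∈ Set.Icc (0 : ℝ) (4 * (k : ℝ) ^ 2) := by
  induction k with
  | zero => simp
  | succ k ih =>
    have h := hf.slope v k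
    have hk : (0 : ℝ) ≤ k := k.cast_nonneg
    simp only [Set.mem_Icc] at h ih ⊢
    push_cast
    rw [show v + (k + 1) = v + k + 1 by ring]
    constructor <;> nlinarith [h.1, h.2, ih.1, ih.2]

lemma IsConvexSeq.growth_right {f : ℕ → ℝ} (hf : IsConvexSeq f) (v d k : ℕ) :
    (k : ℝ) * d / 4 ≤ f (v + d + k) - f (v + d) - k * (f (v + 1) - f v) := by
  induction k with
  | zero => simp
  | succ k ih =>
    have h := (hf.slope v (d + k)).1
    have hk : (0 : ℝ) ≤ k := k.cast_nonneg
    push_cast at h ⊢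
    rw [show v + d + (k + 1) = v + (d + k) + 1 by ring]
    rw [show v + d + k = v + (d + k) by ring] at ih
    linarith

lemma IsConvexSeq.growth_left {f : ℕ → ℝ} (hf : IsConvexSeq f) (m k d : ℕ) :
    f (m + k) - f m - k * (f (m + k + d + 1) - f (m + k + d)) ≤ -((k : ℝ) * d / 4) := by
  induction k generalizing m with
  | zero => simp
  | succ k ih =>
    have h := (hf.slope m (k + 1 + d)).1
    have ih := ih (m + 1)
    have hk : (0 : ℝ) ≤ k := k.cast_nonneg
    push_cast at h ⊢
    rw [show m + (k + 1 + d) = m + 1 + k + d by ring] at h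
    rw [show m + (k + 1) = m + 1 + k by ring]
    linarith

lemma IsConvexSeq.mul_abs_sub_le {f : ℕ → ℝ} (hf : IsConvexSeq f) {v D x₁ x₂ : ℕ}
    (h : (v + D ≤ x₁ ∧ v + D ≤ x₂) ∨ (x₁ + D ≤ v ∧ x₂ + D ≤ v)) :
    |(x₁ : ℝ) - x₂| * D ≤ 4 * |f x₁ - f x₂ - (x₁ - x₂) * (f (v + 1) - f v)| := by
  wlog hx : x₁ ≤ x₂ generalizing x₁ x₂
  · have := this (x₁ := x₂) (x₂ := x₁) (by tauto) (by omega)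
    rw [abs_sub_comm (x₁ : ℝ)]
    refine this.trans (le_of_eq ?_)
    rw [← abs_neg]
    ring_nf
  obtain ⟨k, rfl⟩ := Nat.exists_eq_add_of_le hx
  have hk : (0 : ℝ) ≤ k := k.cast_nonneg
  have e1 : |(x₁ : ℝ) - ((x₁ + k : ℕ) : ℝ)| = k := by
    push_cast
    rw [show (x₁ : ℝ) - (x₁ + k) = -k by ring, abs_neg, abs_of_nonneg hk]
  rw [e1]
  push_cast
  rcases h with h | h
  · obtain ⟨d, rfl⟩ := Nat.exists_eq_add_of_le (le_trans (Nat.le_add_right v D) h.1)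
    have h1 := hf.growth_right v d k
    have hd : (D : ℝ) ≤ d := by exact_mod_cast (by omega : D ≤ d)
    have h2 := mul_le_mul_of_nonneg_left hd hk
    have h3 := neg_abs_le (f (v + d) - f (v + d + k) -
      (((v + d : ℕ) : ℝ) - (((v + d : ℕ) : ℝ) + k)) * (f (v + 1) - f v))
    linarith
  · obtain ⟨d, rfl⟩ := Nat.exists_eq_add_of_le (le_trans (Nat.le_add_right (x₁ + k) D) h.2)
    have h1 := hf.growth_left x₁ k d
    have hd : (D : ℝ) ≤ d := by exact_mod_cast (by omega : D ≤ d)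
    have h2 := mul_le_mul_of_nonneg_left hd hk
    have h3 := le_abs_self (f x₁ - f (x₁ + k) -
      ((x₁ : ℝ) - (x₁ + k)) * (f (x₁ + k + d + 1) - f (x₁ + k + d)))
    linarith

/-- In a sextuple with four entries in a short interval, the two others are close. -/
lemma IsConvexSeq.abs_sub_mul_le {f : ℕ → ℝ} (hf : IsConvexSeq f)
    {v l D x₁ x₂ y₁ y₂ y₃ y₄ : ℕ} (hl : 1 ≤ l)
    (h : (v + D ≤ x₁ ∧ v + D ≤ x₂) ∨ (x₁ + D ≤ v ∧ x₂ + D ≤ v))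
    (h₁ : v ≤ y₁ ∧ y₁ ≤ v + l) (h₂ : v ≤ y₂ ∧ y₂ ≤ v + l)
    (h₃ : v ≤ y₃ ∧ y₃ ≤ v + l) (h₄ : v ≤ y₄ ∧ y₄ ≤ v + l)
    (hs : x₁ + y₁ + y₂ = x₂ + y₃ + y₄)
    (hfs : |f x₁ + f y₁ + f y₂ - (f x₂ + f y₃ + f y₄)| ≤ 3) :
    |(x₁ : ℝ) - x₂| * D ≤ 44 * (l : ℝ) ^ 2 := by
  have key : ∀ y : ℕ, v ≤ y ∧ y ≤ v + l →
      0 ≤ f y - f v - (y - v) * (f (v + 1) - f v) ∧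
      f y - f v - (y - v) * (f (v + 1) - f v) ≤ 4 * (l : ℝ) ^ 2 := by
    rintro y ⟨hy, hy'⟩
    obtain ⟨k, rfl⟩ := Nat.exists_eq_add_of_le hy
    have hk : (k : ℝ) ≤ l := by exact_mod_cast (by omega : k ≤ l)
    have hk0 : (0 : ℝ) ≤ k := k.cast_nonneg
    have := hf.tangent v k
    push_cast
    rw [add_sub_cancel_left]
    exact ⟨this.1, this.2.trans (by gcongr)⟩
  have hl' : (1 : ℝ) ≤ (l : ℝ) ^ 2 := one_le_pow₀ (by exact_mod_cast hl)
  have hs' : (x₁ : ℝ) + y₁ + y₂ = x₂ + y₃ + y₄ := by exact_mod_cast hs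
  refine (hf.mul_abs_sub_le h).trans ?_
  suffices |f x₁ - f x₂ - (x₁ - x₂) * (f (v + 1) - f v)| ≤ 11 * (l : ℝ) ^ 2 by linarith
  have k1 := key y₁ h₁
  have k2 := key y₂ h₂
  have k3 := key y₃ h₃
  have k4 := key y₄ h₄
  set s := f (v + 1) - f v
  have e : (x₁ : ℝ) - x₂ = y₃ + y₄ - y₁ - y₂ := by linarith
  rw [e]
  rw [abs_le] at hfs ⊢
  constructor <;> nlinarith [hfs.1, hfs.2]

/-! ### Exponential sums -/

section Sums

variable {T : Type} [Fintype T] {f : ℕ → ℝ} {e : ℕ → T → ℂ}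

lemma exists_of_sum_expSum_mul_ne_zero {A : Finset ℕ} {w : T → ℂ}
    (h : ∑ x, expSum e A x * w x ≠ 0) : ∃ n ∈ A, ∑ x, e n x * w x ≠ 0 := by
  apply Finset.exists_ne_zero_of_sum_ne_zero
  rw [Finset.sum_comm]
  simpa only [expSum, Finset.sum_mul] using h

lemma exists_of_sum_conj_expSum_mul_ne_zero {A : Finset ℕ} {w : T → ℂ}
    (h : ∑ x, conj (expSum e A x) * w x ≠ 0) : ∃ n ∈ A, ∑ x, conj (e n x) * w x ≠ 0 := by
  apply Finset.exists_ne_zero_of_sum_ne_zero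
  rw [Finset.sum_comm]
  simpa only [expSum, Finset.sum_mul, map_sum] using h

lemma IsSystem.exists_sextuple (he : IsSystem f e) {A A' B : Finset ℕ}
    (h : ∑ x, expSum e A x * conj (expSum e A' x) * ((‖expSum e B x‖ ^ 4 : ℝ) : ℂ) ≠ 0) :
    ∃ x₁ ∈ A, ∃ x₂ ∈ A', ∃ y₁ ∈ B, ∃ y₂ ∈ B, ∃ y₃ ∈ B, ∃ y₄ ∈ B,
      x₁ + y₁ + y₂ = x₂ + y₃ + y₄ ∧ |f x₁ + f y₁ + f y₂ - (f x₂ + f y₃ + f y₄)| ≤ 3 := by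
  have hn : ∀ x, ((‖expSum e B x‖ ^ 4 : ℝ) : ℂ) =
      expSum e B x * expSum e B x * conj (expSum e B x) * conj (expSum e B x) := by
    intro x
    have := Complex.mul_conj' (expSum e B x)
    push_cast
    linear_combination (-((‖expSum e B x‖ : ℂ) ^ 2) -
      expSum e B x * conj (expSum e B x)) * this
  have h : ∑ x, expSum e A x * (conj (expSum e A' x) * (expSum e B x * (expSum e B x *
      (conj (expSum e B x) * conj (expSum e B x))))) ≠ 0 := by
    convert h using 2 with x
    rw [hn]; ring
  obtain ⟨x₁, hx₁, h⟩ := exists_of_sum_expSum_mul_ne_zero h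
  have h : ∑ x, conj (expSum e A' x) * (e x₁ x * (expSum e B x * (expSum e B x *
      (conj (expSum e B x) * conj (expSum e B x))))) ≠ 0 := by
    convert h using 2 with x; ring
  obtain ⟨x₂, hx₂, h⟩ := exists_of_sum_conj_expSum_mul_ne_zero h
  have h : ∑ x, expSum e B x * (conj (e x₂ x) * e x₁ x * (expSum e B x *
      (conj (expSum e B x) * conj (expSum e B x)))) ≠ 0 := by
    convert h using 2 with x; ring
  obtain ⟨y₁, hy₁, h⟩ := exists_of_sum_expSum_mul_ne_zero h
  have h : ∑ x, expSum e B x * (e y₁ x * conj (e x₂ x) * e x₁ x *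
      (conj (expSum e B x) * conj (expSum e B x))) ≠ 0 := by
    convert h using 2 with x; ring
  obtain ⟨y₂, hy₂, h⟩ := exists_of_sum_expSum_mul_ne_zero h
  have h : ∑ x, conj (expSum e B x) * (e y₂ x * e y₁ x * conj (e x₂ x) * e x₁ x *
      conj (expSum e B x)) ≠ 0 := by
    convert h using 2 with x; ring
  obtain ⟨y₃, hy₃, h⟩ := exists_of_sum_conj_expSum_mul_ne_zero h
  have h : ∑ x, conj (expSum e B x) *
      (conj (e y₃ x) * e y₂ x * e y₁ x * conj (e x₂ x) * e x₁ x) ≠ 0 := by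
    convert h using 2 with x; ring
  obtain ⟨y₄, hy₄, h⟩ := exists_of_sum_conj_expSum_mul_ne_zero h
  refine ⟨x₁, hx₁, x₂, hx₂, y₁, hy₁, y₂, hy₂, y₃, hy₃, y₄, hy₄, he.orth _ _ _ _ _ _ ?_⟩
  convert h using 2 with x; ring

/-- Almost orthogonality for a family that is only locally correlated. -/
lemma sum_sq_le_of_local {F : ℕ → T → ℂ} {w : T → ℝ} (hw : ∀ x, 0 ≤ w x) (s : Finset ℕ) (c : ℕ)
    (h : ∀ i ∈ s, ∀ j ∈ s, ∑ x, F i x * conj (F j x) * (w x : ℂ) ≠ 0 → i ≤ j + c ∧ j ≤ i + c) :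
    ∑ x, ‖∑ i ∈ s, F i x‖ ^ 2 * w x ≤ (2 * c + 1) * ∑ i ∈ s, ∑ x, ‖F i x‖ ^ 2 * w x := by
  set a : ℕ → ℝ := fun i => ∑ x, ‖F i x‖ ^ 2 * w x with ha
  have ha0 : ∀ i, 0 ≤ a i := fun i => Finset.sum_nonneg fun x _ => by have := hw x; positivity
  have hexp : ((∑ x, ‖∑ i ∈ s, F i x‖ ^ 2 * w x : ℝ) : ℂ) =
      ∑ i ∈ s, ∑ j ∈ s, ∑ x, F i x * conj (F j x) * (w x : ℂ) := by
    push_cast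
    simp_rw [← Complex.mul_conj', map_sum, Finset.sum_mul_sum, Finset.sum_mul]
    rw [Finset.sum_comm]
    refine Finset.sum_congr rfl fun i _ => ?_
    rw [Finset.sum_comm]
  have hterm : ∀ i ∈ s, ∀ j ∈ s, ‖∑ x, F i x * conj (F j x) * (w x : ℂ)‖ ≤
      if i ≤ j + c ∧ j ≤ i + c then (a i + a j) / 2 else 0 := by
    intro i hi j hj
    split_ifs with hij
    · calc ‖∑ x, F i x * conj (F j x) * (w x : ℂ)‖
          ≤ ∑ x, ‖F i x * conj (F j x) * (w x : ℂ)‖ := norm_sum_le _ _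
        _ ≤ ∑ x, (‖F i x‖ ^ 2 * w x + ‖F j x‖ ^ 2 * w x) / 2 := by
          refine Finset.sum_le_sum fun x _ => ?_
          rw [norm_mul, norm_mul, RCLike.norm_conj, Complex.norm_real, Real.norm_of_nonneg (hw x)]
          nlinarith [mul_nonneg (sq_nonneg (‖F i x‖ - ‖F j x‖)) (hw x)]
        _ = (a i + a j) / 2 := by
          rw [← Finset.sum_div, Finset.sum_add_distrib]
    · by_contra hne
      rw [not_le, norm_pos_iff] at hne
      exact hij (h i hi j hj hne)
  have hcard : ∀ i, ((s.filter fun j => i ≤ j + c ∧ j ≤ i + c).card : ℝ) ≤ 2 * c + 1 := by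
    intro i
    have h1 : (s.filter fun j => i ≤ j + c ∧ j ≤ i + c) ⊆ Finset.Icc (i - c) (i + c) := by
      intro j hj
      simp only [Finset.mem_filter, Finset.mem_Icc] at hj ⊢
      omega
    have h2 := Finset.card_le_card h1
    rw [Nat.card_Icc] at h2
    exact_mod_cast (by omega : (s.filter fun j => i ≤ j + c ∧ j ≤ i + c).card ≤ 2 * c + 1)
  have hone : ∀ i, ∑ j ∈ s, (if i ≤ j + c ∧ j ≤ i + c then a i else 0) ≤ (2 * c + 1) * a i := by
    intro i
    rw [← Finset.sum_filter, Finset.sum_const, nsmul_eq_mul]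
    exact mul_le_mul_of_nonneg_right (hcard i) (ha0 i)
  have hsum : ∑ i ∈ s, ∑ j ∈ s, (if i ≤ j + c ∧ j ≤ i + c then (a i + a j) / 2 else 0) ≤
      (2 * c + 1) * ∑ i ∈ s, a i := by
    have h1 : ∑ i ∈ s, ∑ j ∈ s, (if i ≤ j + c ∧ j ≤ i + c then a i else 0) ≤
        (2 * c + 1) * ∑ i ∈ s, a i := by
      rw [Finset.mul_sum]
      exact Finset.sum_le_sum fun i _ => hone i
    have h2 : ∑ i ∈ s, ∑ j ∈ s, (if i ≤ j + c ∧ j ≤ i + c then a j else 0) ≤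
        (2 * c + 1) * ∑ i ∈ s, a i := by
      rw [Finset.sum_comm]
      simpa only [and_comm] using h1
    have h3 : ∑ i ∈ s, ∑ j ∈ s, (if i ≤ j + c ∧ j ≤ i + c then (a i + a j) / 2 else 0) =
        (∑ i ∈ s, ∑ j ∈ s, (if i ≤ j + c ∧ j ≤ i + c then a i else 0) +
          ∑ i ∈ s, ∑ j ∈ s, (if i ≤ j + c ∧ j ≤ i + c then a j else 0)) / 2 := by
      simp_rw [← Finset.sum_add_distrib, Finset.sum_div]
      refine Finset.sum_congr rfl fun i _ => Finset.sum_congr rfl fun j _ => ?_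
      split_ifs <;> simp
    rw [h3]; linarith
  calc ∑ x, ‖∑ i ∈ s, F i x‖ ^ 2 * w x
      ≤ ‖((∑ x, ‖∑ i ∈ s, F i x‖ ^ 2 * w x : ℝ) : ℂ)‖ := by
        rw [Complex.norm_real]; exact Real.le_norm_self _
    _ ≤ ∑ i ∈ s, ∑ j ∈ s, ‖∑ x, F i x * conj (F j x) * (w x : ℂ)‖ := by
        rw [hexp]
        exact (norm_sum_le _ _).trans (Finset.sum_le_sum fun i _ => norm_sum_le _ _)
    _ ≤ _ := (Finset.sum_le_sum fun i hi => Finset.sum_le_sum fun j hj => hterm i hi j hj).trans hsum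

lemma sq_sum_mixed_le (A B : Finset ℕ) :
    (∑ x, ‖expSum e A x‖ ^ 2 * ‖expSum e B x‖ ^ 4) ^ 2 ≤
      (∑ x, ‖expSum e B x‖ ^ 2 * ‖expSum e A x‖ ^ 4) * ∑ x, ‖expSum e B x‖ ^ 6 := by
  have := Finset.sum_mul_sq_le_sq_mul_sq Finset.univ
    (fun x => ‖expSum e A x‖ ^ 2 * ‖expSum e B x‖) (fun x => ‖expSum e B x‖ ^ 3)
  refine le_of_eq_of_le ?_ (this.trans_eq ?_)
  · congr 1
    exact Finset.sum_congr rfl fun x _ => by ring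
  · congr 1 <;> exact Finset.sum_congr rfl fun x _ => by ring

end Sums

/-! ### Splitting into blocks -/

lemma expSum_eq_sum_blocks {T : Type} (e : ℕ → T → ℂ) (A : Finset ℕ) (l : ℕ) (x : T) :
    expSum e A x = ∑ j ∈ A.image (· / l), expSum e (A.filter (· / l = j)) x :=
  (Finset.sum_fiberwise_of_maps_to (fun _ h => Finset.mem_image_of_mem _ h) _).symm

lemma isWindow_block (A : Finset ℕ) {l : ℕ} (hl : 1 ≤ l) (j : ℕ) :
    IsWindow l (A.filter (· / l = j)) := by
  refine ⟨j * l, fun n hn => ?_⟩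
  obtain ⟨-, rfl⟩ := Finset.mem_filter.1 hn
  have h1 := Nat.div_add_mod n l
  have h2 := Nat.mod_lt n hl
  rw [mul_comm] at h1
  rw [Finset.mem_Ico]
  omega

lemma card_blocks_le {A : Finset ℕ} {l k : ℕ} (hl : 1 ≤ l) (hA : IsWindow (k * l) A) :
    (A.image (· / l)).card ≤ k + 1 := by
  obtain ⟨u, hu⟩ := hA
  have : A.image (· / l) ⊆ Finset.Icc (u / l) (u / l + k) := by
    intro j hj
    obtain ⟨n, hn, rfl⟩ := Finset.mem_image.1 hj
    have h := Finset.mem_Ico.1 (hu hn)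
    rw [Finset.mem_Icc, ← Nat.add_mul_div_right u k hl]
    exact ⟨Nat.div_le_div_right h.1, Nat.div_le_div_right h.2.le⟩
  refine (Finset.card_le_card this).trans ?_
  rw [Nat.card_Icc]; omega

lemma IsWindow.mono {A : Finset ℕ} {l l' : ℕ} (h : IsWindow l A) (hl : l ≤ l') :
    IsWindow l' A := by
  obtain ⟨u, hu⟩ := h
  exact ⟨u, hu.trans (Finset.Ico_subset_Ico_right (by omega))⟩

lemma Separated.symm {D : ℕ} {A B : Finset ℕ} (h : Separated D A B) : Separated D B A := by
  rcases h with h | h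
  · exact Or.inr fun b hb a ha => h a ha b hb
  · exact Or.inl fun b hb a ha => h a ha b hb

lemma Separated.mono {D : ℕ} {A B A' B' : Finset ℕ} (h : Separated D A B) (hA : A' ⊆ A)
    (hB : B' ⊆ B) : Separated D A' B' := by
  rcases h with h | h
  · exact Or.inl fun b hb a ha => h b (hA hb) a (hB ha)
  · exact Or.inr fun b hb a ha => h b (hA hb) a (hB ha)

section Bilinear

variable {T : Type} [Fintype T] {f : ℕ → ℝ} {e : ℕ → T → ℂ}

lemma IsSystem.mixed_le_sum_blocks (he : IsSystem f e) {l l' D κ : ℕ} (hl : 1 ≤ l) (hl' : 1 ≤ l')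
    (hD : 1 ≤ D) (h : l ^ 2 ≤ κ * D * l') {A B : Finset ℕ} (hB : IsWindow l B)
    (hAB : Separated D A B) :
    ∑ x, ‖expSum e A x‖ ^ 2 * ‖expSum e B x‖ ^ 4 ≤ (2 * (44 * κ : ℕ) + 1) *
      ∑ j ∈ A.image (· / l'), ∑ x,
        ‖expSum e (A.filter (· / l' = j)) x‖ ^ 2 * ‖expSum e B x‖ ^ 4 := by
  simp_rw [expSum_eq_sum_blocks e A l']
  refine sum_sq_le_of_local (w := fun x => ‖expSum e B x‖ ^ 4) (fun x => by positivity) _ _ ?_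
  intro i _ j _ hij
  obtain ⟨x₁, hx₁, x₂, hx₂, y₁, hy₁, y₂, hy₂, y₃, hy₃, y₄, hy₄, hs, hfs⟩ := he.exists_sextuple hij
  obtain ⟨hxA₁, rfl⟩ := Finset.mem_filter.1 hx₁
  obtain ⟨hxA₂, rfl⟩ := Finset.mem_filter.1 hx₂
  have hne : B.Nonempty := ⟨y₁, hy₁⟩
  obtain ⟨u, hu⟩ := hB
  have hv : ∀ y ∈ B, B.min' hne ≤ y ∧ y ≤ B.min' hne + l := by
    intro y hy
    have h1 := Finset.mem_Ico.1 (hu hy)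
    have h2 := Finset.mem_Ico.1 (hu (B.min'_mem hne))
    exact ⟨B.min'_le y hy, by omega⟩
  have hside : (B.min' hne + D ≤ x₁ ∧ B.min' hne + D ≤ x₂) ∨
      (x₁ + D ≤ B.min' hne ∧ x₂ + D ≤ B.min' hne) := by
    have hm := B.min'_mem hne
    rcases hAB with hAB | hAB
    · exact Or.inr ⟨hAB _ hxA₁ _ hm, hAB _ hxA₂ _ hm⟩
    · exact Or.inl ⟨hAB _ hxA₁ _ hm, hAB _ hxA₂ _ hm⟩
  have hdist := he.convex.abs_sub_mul_le hl hside (hv _ hy₁) (hv _ hy₂) (hv _ hy₃) (hv _ hy₄) hs hfs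
  have hbound : |(x₁ : ℝ) - x₂| ≤ 44 * κ * l' := by
    have h1 : (l : ℝ) ^ 2 ≤ κ * D * l' := by exact_mod_cast h
    have h2 : (0 : ℝ) < D := by exact_mod_cast hD
    refine le_of_mul_le_mul_right ?_ h2
    linarith
  rw [abs_le] at hbound
  have h1 : x₁ ≤ x₂ + 44 * κ * l' := by
    have : (x₁ : ℝ) ≤ x₂ + 44 * κ * l' := by linarith
    exact_mod_cast this
  have h2 : x₂ ≤ x₁ + 44 * κ * l' := by
    have : (x₂ : ℝ) ≤ x₁ + 44 * κ * l' := by linarith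
    exact_mod_cast this
  rw [← Nat.add_mul_div_right _ _ hl', ← Nat.add_mul_div_right _ _ hl']
  exact ⟨Nat.div_le_div_right h1, Nat.div_le_div_right h2⟩

lemma MomentBound.mixed_le {G lam : ℝ} (hM : MomentBound e G lam) {L : ℕ} (hL : 1 ≤ L)
    {A B : Finset ℕ} (hA : IsWindow L A) (hB : IsWindow L B) :
    ∑ x, ‖expSum e A x‖ ^ 2 * ‖expSum e B x‖ ^ 4 ≤ 2 * G * (L : ℝ) ^ lam := by
  have hp : ∀ s t : ℝ, 0 ≤ s → 0 ≤ t → s ^ 2 * t ^ 4 ≤ s ^ 6 + t ^ 6 := by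
    intro s t hs ht
    rcases le_total s t with h | h
    · have : s ^ 2 * t ^ 4 ≤ t ^ 2 * t ^ 4 := by gcongr
      nlinarith [pow_nonneg hs 6]
    · have : s ^ 2 * t ^ 4 ≤ s ^ 2 * s ^ 4 := by gcongr
      nlinarith [pow_nonneg ht 6]
  calc ∑ x, ‖expSum e A x‖ ^ 2 * ‖expSum e B x‖ ^ 4
      ≤ ∑ x, (‖expSum e A x‖ ^ 6 + ‖expSum e B x‖ ^ 6) :=
        Finset.sum_le_sum fun x _ => hp _ _ (norm_nonneg _) (norm_nonneg _)
    _ ≤ 2 * G * (L : ℝ) ^ lam := by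
        rw [Finset.sum_add_distrib]
        linarith [hM L A hL hA, hM L B hL hB]

/-- The iteration at the heart of the argument: at scale `q ^ (2 ^ n)`, a mixed moment over windows
of lengths `q ^ (2 ^ n - a)` and `q ^ (2 ^ n - 2 ^ k)`. -/
lemma IsSystem.mixed_iterate (he : IsSystem f e) {G η : ℝ}
    (hG : 0 ≤ G) (hM : MomentBound e G (3 + η)) {n q D κ : ℕ} (hq : 1 ≤ q) (hD : 1 ≤ D)
    (hκ : q ^ 2 ^ n ≤ κ * D) (m k a : ℕ) (hn : n = k + m) (ha : a ≤ 2 ^ k) (A B : Finset ℕ)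
    (hA : IsWindow (q ^ (2 ^ n - a)) A) (hB : IsWindow (q ^ (2 ^ n - 2 ^ k)) B)
    (hAB : Separated D A B) :
    ∑ x, ‖expSum e A x‖ ^ 2 * ‖expSum e B x‖ ^ 4 ≤ 4 * (2 * (44 * κ : ℕ) + 1) ^ 2 * G *
      (q : ℝ) ^ (3 * 2 ^ n - (a : ℝ) - 2 * 2 ^ k + (η * 2 ^ n + 2 ^ k * (3 - η * m / 2))) := by
  set c : ℝ := 2 * (44 * κ : ℕ) + 1 with hc
  have hc1 : 1 ≤ c := by rw [hc]; have : (0:ℝ) ≤ (44 * κ : ℕ) := Nat.cast_nonneg _; linarith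
  have hq1 : (1 : ℝ) ≤ q := by exact_mod_cast hq
  have hq0 : (0 : ℝ) < q := by linarith
  induction m generalizing k a A B with
  | zero =>
    obtain rfl : n = k := by simpa using hn
    have hA' : IsWindow (q ^ 2 ^ n) A := hA.mono (Nat.pow_le_pow_right hq (Nat.sub_le _ _))
    have hB' : IsWindow (q ^ 2 ^ n) B := hB.mono (Nat.pow_le_pow_right hq (Nat.sub_le _ _))
    have h1 := hM.mixed_le (Nat.one_le_pow _ _ hq) hA' hB'
    have ha' : (a : ℝ) ≤ 2 ^ n := by exact_mod_cast ha
    have h2 : (((q ^ 2 ^ n : ℕ) : ℝ)) ^ (3 + η) ≤ (q : ℝ) ^ (3 * 2 ^ n - (a : ℝ) - 2 * 2 ^ n +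
        (η * 2 ^ n + 2 ^ n * (3 - η * (0 : ℕ) / 2))) := by
      push_cast
      rw [← Real.rpow_natCast (q : ℝ), ← Real.rpow_mul hq0.le]
      apply Real.rpow_le_rpow_of_exponent_le hq1
      push_cast
      linarith
    refine h1.trans (mul_le_mul ?_ h2 (by positivity) (by positivity))
    have : 1 ≤ c ^ 2 := one_le_pow₀ hc1
    nlinarith
  | succ m ih =>
    have hN : 2 * 2 ^ k ≤ 2 ^ n := by
      rw [← pow_succ']; exact Nat.pow_le_pow_right (by norm_num) (by omega)
    set N := 2 ^ n with hNdef
    set E := 2 ^ k with hE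
    have hE1 : 1 ≤ E := Nat.one_le_two_pow
    have hEr : (E : ℝ) = 2 ^ k := by rw [hE]; push_cast; rfl
    have hNr : (N : ℝ) = 2 ^ n := by rw [hNdef]; push_cast; rfl
    clear_value N E
    set l' := q ^ (N - 2 * E) with hl'
    have hl'1 : 1 ≤ l' := Nat.one_le_pow _ _ hq
    have hblock : q ^ (N - a) = q ^ (2 * E - a) * l' := by
      rw [hl', ← pow_add]; congr 1; omega
    have hcard := card_blocks_le hl'1 (hblock ▸ hA)
    have hcard' : ((A.image (· / l')).card : ℝ) ≤ 2 * (q : ℝ) ^ (2 * (E : ℝ) - a) := by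
      have h1 : 1 ≤ q ^ (2 * E - a) := Nat.one_le_pow _ _ hq
      have h2 : (A.image (· / l')).card ≤ 2 * q ^ (2 * E - a) := by omega
      have h3 : (q : ℝ) ^ (2 * (E : ℝ) - a) = ((q ^ (2 * E - a) : ℕ) : ℝ) := by
        rw [Nat.cast_pow, ← Real.rpow_natCast, Nat.cast_sub (by omega)]
        push_cast; rfl
      rw [h3]; exact_mod_cast h2
    have hsq : (q ^ (N - E)) ^ 2 ≤ κ * D * l' := by
      calc (q ^ (N - E)) ^ 2 = q ^ N * l' := by
            rw [hl', ← pow_mul, ← pow_add]; congr 1; omega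
        _ ≤ κ * D * l' := Nat.mul_le_mul_right _ hκ
    have horth := he.mixed_le_sum_blocks (Nat.one_le_pow _ _ hq) hl'1 hD hsq hB hAB
    set X : ℝ := 3 * (2 : ℝ) ^ n - (E : ℝ) - 2 * 2 ^ (k + 1) +
      (η * 2 ^ n + 2 ^ (k + 1) * (3 - η * m / 2)) with hX
    set Y : ℝ := ((2 : ℝ) ^ n - 2 ^ k) * (3 + η) with hY
    have hblk : ∀ j ∈ A.image (· / l'), ∑ x,
        ‖expSum e (A.filter (· / l' = j)) x‖ ^ 2 * ‖expSum e B x‖ ^ 4 ≤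
          2 * c * G * (q : ℝ) ^ ((X + Y) / 2) := by
      intro j _
      have hAj : IsWindow (q ^ (N - 2 ^ (k + 1))) (A.filter (· / l' = j)) := by
        rw [pow_succ', ← hE]
        exact isWindow_block A hl'1 j
      have h1 := ih (k + 1) E (by omega) (by rw [hE, pow_succ']; omega) B
        (A.filter (· / l' = j)) hB hAj (hAB.symm.mono (le_refl _) (Finset.filter_subset _ _))
      have h2 := hM _ B (Nat.one_le_pow (N - E) q hq) hB
      have h2' : ((q ^ (N - E) : ℕ) : ℝ) ^ (3 + η) = (q : ℝ) ^ Y := by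
        rw [Nat.cast_pow, ← Real.rpow_natCast, ← Real.rpow_mul hq0.le, Nat.cast_sub (by omega)]
        rw [hY, hNr, hEr]
      rw [h2'] at h2
      have h3 := sq_sum_mixed_le (e := e) (A.filter (· / l' = j)) B
      refine (pow_le_pow_iff_left₀ (by positivity) (by positivity) two_ne_zero).1 ?_
      refine h3.trans ((mul_le_mul h1 h2 (by positivity) (by positivity)).trans (le_of_eq ?_))
      have h4 : ((q : ℝ) ^ ((X + Y) / 2)) ^ 2 = (q : ℝ) ^ X * (q : ℝ) ^ Y := by
        rw [← Real.rpow_add hq0, ← Real.rpow_natCast, ← Real.rpow_mul hq0.le]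
        congr 1; push_cast; ring
      rw [mul_pow, h4]; ring
    calc _ ≤ c * ∑ j ∈ A.image (· / l'), 2 * c * G * (q : ℝ) ^ ((X + Y) / 2) :=
          horth.trans (mul_le_mul_of_nonneg_left (Finset.sum_le_sum hblk) (by linarith))
      _ = c * ((A.image (· / l')).card * (2 * c * G * (q : ℝ) ^ ((X + Y) / 2))) := by
          rw [Finset.sum_const, nsmul_eq_mul]
      _ ≤ c * (2 * (q : ℝ) ^ (2 * (E : ℝ) - a) * (2 * c * G * (q : ℝ) ^ ((X + Y) / 2))) := by
          gcongr
      _ = 4 * c ^ 2 * G * ((q : ℝ) ^ (2 * (E : ℝ) - a) * (q : ℝ) ^ ((X + Y) / 2)) := by ring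
      _ = _ := by
          rw [← Real.rpow_add hq0, hX, hY, hEr]
          congr 2
          push_cast
          ring

end Bilinear

/-- Bilinear estimate over windows of length `L` separated by a gap comparable to `L`. -/
lemma exists_mixed_bound (n K : ℕ) {η : ℝ} (hη : 12 ≤ η * n) : ∃ c : ℝ, 0 ≤ c ∧
    ∀ {T : Type} [Fintype T] {f : ℕ → ℝ} {e : ℕ → T → ℂ} {G : ℝ}, IsSystem f e → 0 ≤ G →
      MomentBound e G (3 + η) → ∀ {L D : ℕ} {A B : Finset ℕ}, 1 ≤ L → 1 ≤ D → L ≤ K * D →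
        IsWindow L A → IsWindow L B → Separated D A B →
          ∑ x, ‖expSum e A x‖ ^ 2 * ‖expSum e B x‖ ^ 4 ≤
            c * G * (L : ℝ) ^ (3 + η - ((2 : ℝ) ^ n)⁻¹) := by
  refine ⟨16 * (4 * (2 * (44 * (2 ^ 2 ^ n * K) : ℕ) + 1) ^ 2) *
    (((2 ^ 2 ^ n : ℕ) : ℝ)) ^ (3 + η - ((2 : ℝ) ^ n)⁻¹), by positivity, ?_⟩
  intro T _ f e G he hG hM L D A B hL hD hLD hA hB hAB
  set c₁ : ℝ := 4 * (2 * (44 * (2 ^ 2 ^ n * K) : ℕ) + 1) ^ 2 with hc₁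
  have hη0 : 0 ≤ η := by
    by_contra h
    push Not at h
    nlinarith [(Nat.cast_nonneg n : (0 : ℝ) ≤ n)]
  have hN1 : 1 ≤ 2 ^ n := Nat.one_le_two_pow
  obtain ⟨q, hq, hLq, hqL⟩ : ∃ q : ℕ, 1 ≤ q ∧ L ≤ q ^ 2 ^ n ∧ q ^ 2 ^ n ≤ 2 ^ 2 ^ n * L := by
    have hL1 : (1 : ℝ) ≤ L := by exact_mod_cast hL
    set r : ℝ := (L : ℝ) ^ (((2 ^ n : ℕ) : ℝ)⁻¹) with hr
    have hr1 : 1 ≤ r := Real.one_le_rpow hL1 (by positivity)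
    have hrN : r ^ 2 ^ n = L := Real.rpow_inv_natCast_pow (by positivity) (by positivity)
    have h1 : r ≤ ⌈r⌉₊ := Nat.le_ceil r
    have h2 : (⌈r⌉₊ : ℝ) ≤ 2 * r := by linarith [Nat.ceil_lt_add_one (zero_le_one.trans hr1)]
    refine ⟨⌈r⌉₊, Nat.one_le_ceil_iff.2 (by linarith), ?_, ?_⟩
    · have : (L : ℝ) ≤ (⌈r⌉₊ : ℝ) ^ 2 ^ n := by rw [← hrN]; gcongr
      exact_mod_cast this
    · have : (⌈r⌉₊ : ℝ) ^ 2 ^ n ≤ 2 ^ 2 ^ n * L := by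
        rw [← hrN, ← mul_pow]; gcongr
      exact_mod_cast this
  have hq1 : (1 : ℝ) ≤ q := by exact_mod_cast hq
  have hq0 : (0 : ℝ) < q := by linarith
  have hκ : q ^ 2 ^ n ≤ 2 ^ 2 ^ n * K * D :=
    hqL.trans (by rw [mul_assoc]; exact Nat.mul_le_mul_left _ hLD)
  have hl1 : 1 ≤ q ^ (2 ^ n - 1) := Nat.one_le_pow _ _ hq
  have hsplit : q ^ 2 ^ n = q * q ^ (2 ^ n - 1) := by
    rw [← pow_succ']; congr 1; omega
  set s := B.image (· / q ^ (2 ^ n - 1)) with hs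
  have hcard : (s.card : ℝ) ≤ 2 * q := by
    have : s.card ≤ q + 1 := card_blocks_le hl1 (hsplit ▸ hB.mono hLq)
    exact_mod_cast (by omega : s.card ≤ 2 * q)
  set F : ℕ → T → ℂ := fun j => expSum e (B.filter (· / q ^ (2 ^ n - 1) = j)) with hF
  set W : ℝ := 3 * 2 ^ n - ((0 : ℕ) : ℝ) - 2 * 2 ^ 0 + (η * 2 ^ n + 2 ^ 0 * (3 - η * n / 2)) with hW
  have hblk : ∀ j ∈ s, ∑ x, ‖expSum e A x‖ ^ 2 * ‖F j x‖ ^ 4 ≤ c₁ * G * (q : ℝ) ^ W := by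
    intro j _
    refine he.mixed_iterate hG hM hq hD hκ n 0 0 (by simp) (by simp) A _
      (hA.mono (by simpa using hLq)) ?_ (hAB.mono (le_refl _) (Finset.filter_subset _ _))
    simpa using isWindow_block B hl1 j
  have hpt : ∀ x, ‖expSum e B x‖ ^ 4 ≤ (2 * q) ^ 3 * ∑ j ∈ s, ‖F j x‖ ^ 4 := by
    intro x
    rw [expSum_eq_sum_blocks e B (q ^ (2 ^ n - 1)) x]
    have h1 := pow_sum_div_card_le_sum_pow (s := s) (f := fun j => ‖F j x‖)
      (fun j _ => norm_nonneg _) 3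
    have h0 : 0 ≤ ∑ j ∈ s, ‖F j x‖ ^ 4 := Finset.sum_nonneg fun j _ => by positivity
    have h2 : (∑ j ∈ s, ‖F j x‖) ^ 4 ≤ (s.card : ℝ) ^ 3 * ∑ j ∈ s, ‖F j x‖ ^ 4 := by
      rcases Nat.eq_zero_or_pos s.card with h | h
      · rw [Finset.card_eq_zero] at h
        simp [h]
      · rw [div_le_iff₀ (by positivity)] at h1
        exact h1.trans_eq (mul_comm _ _)
    calc _ ≤ (∑ j ∈ s, ‖F j x‖) ^ 4 := by gcongr; exact norm_sum_le _ _
      _ ≤ _ := h2.trans (by gcongr)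
  calc ∑ x, ‖expSum e A x‖ ^ 2 * ‖expSum e B x‖ ^ 4
      ≤ ∑ x, ‖expSum e A x‖ ^ 2 * ((2 * q) ^ 3 * ∑ j ∈ s, ‖F j x‖ ^ 4) :=
        Finset.sum_le_sum fun x _ => mul_le_mul_of_nonneg_left (hpt x) (by positivity)
    _ = (2 * q) ^ 3 * ∑ j ∈ s, ∑ x, ‖expSum e A x‖ ^ 2 * ‖F j x‖ ^ 4 := by
        rw [Finset.sum_comm, Finset.mul_sum]
        refine Finset.sum_congr rfl fun x _ => ?_
        rw [← Finset.mul_sum]; ring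
    _ ≤ (2 * q) ^ 3 * ∑ j ∈ s, c₁ * G * (q : ℝ) ^ W := by
        gcongr with j hj
        exact hblk j hj
    _ = (2 * q) ^ 3 * (s.card * (c₁ * G * (q : ℝ) ^ W)) := by
        rw [Finset.sum_const, nsmul_eq_mul]
    _ ≤ (2 * q) ^ 3 * ((2 * q) * (c₁ * G * (q : ℝ) ^ W)) := by gcongr
    _ = 16 * c₁ * G * ((q : ℝ) ^ ((4 : ℕ) : ℝ) * (q : ℝ) ^ W) := by
        rw [Real.rpow_natCast]; ring
    _ ≤ 16 * c₁ * G * (((2 ^ 2 ^ n : ℕ) : ℝ) * L) ^ (3 + η - ((2 : ℝ) ^ n)⁻¹) := by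
        have hinv : ((2 : ℝ) ^ n)⁻¹ ≤ 1 := inv_le_one_of_one_le₀ (one_le_pow₀ (by norm_num))
        refine mul_le_mul_of_nonneg_left ?_ (by positivity)
        rw [← Real.rpow_add hq0]
        calc (q : ℝ) ^ (((4 : ℕ) : ℝ) + W)
            ≤ (q : ℝ) ^ (((2 ^ n : ℕ) : ℝ) * (3 + η - ((2 : ℝ) ^ n)⁻¹)) := by
              apply Real.rpow_le_rpow_of_exponent_le hq1
              have : (2 : ℝ) ^ n * ((2 : ℝ) ^ n)⁻¹ = 1 := mul_inv_cancel₀ (by positivity)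
              rw [hW]
              push_cast
              rw [mul_sub ((2 : ℝ) ^ n), this, pow_zero]
              linarith
          _ = ((q ^ 2 ^ n : ℕ) : ℝ) ^ (3 + η - ((2 : ℝ) ^ n)⁻¹) := by
              rw [Real.rpow_mul hq0.le, Real.rpow_natCast, Nat.cast_pow]
          _ ≤ _ := by
              apply Real.rpow_le_rpow (by positivity) _ (by linarith)
              exact_mod_cast hqL
    _ = _ := by
        rw [Real.mul_rpow (by positivity) (by positivity)]; ring

/-- Either the sum is dominated by its largest terms, or two distant terms are both large. -/
lemma sum_pow_six_le {s : Finset ℕ} {z : ℕ → ℝ} (hz : ∀ i, 0 ≤ z i) {K : ℕ} (hK : 1 ≤ K)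
    (hs : s.card ≤ K) :
    (∑ i ∈ s, z i) ^ 6 ≤ 4 ^ 6 * ∑ i ∈ s, z i ^ 6 +
      (K : ℝ) ^ 9 * ∑ i ∈ s, ∑ j ∈ s.filter (fun j => i + 2 ≤ j ∨ j + 2 ≤ i),
        z i ^ 3 * z j ^ 3 := by
  have hK0 : (0 : ℝ) < K := by exact_mod_cast hK
  have hs' : (s.card : ℝ) ≤ K := by exact_mod_cast hs
  have hA : 0 ≤ ∑ i ∈ s, z i ^ 6 := Finset.sum_nonneg fun i _ => by have := hz i; positivity
  have hB : ∀ i, 0 ≤ ∑ j ∈ s.filter (fun j => i + 2 ≤ j ∨ j + 2 ≤ i), z i ^ 3 * z j ^ 3 :=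
    fun i => Finset.sum_nonneg fun j _ => by have := hz i; have := hz j; positivity
  have hB' := Finset.sum_nonneg fun i (_ : i ∈ s) => hB i
  have h0 : 0 ≤ ∑ i ∈ s, z i := Finset.sum_nonneg fun i _ => hz i
  rcases s.eq_empty_or_nonempty with rfl | hne
  · simp
  obtain ⟨i, hi, hmax⟩ := s.exists_max_image z hne
  by_cases hfar : ∀ j ∈ s.filter (fun j => i + 2 ≤ j ∨ j + 2 ≤ i), z j ≤ z i / K
  · have h1 : ∑ j ∈ s, z j ≤ 4 * z i := by
      rw [← Finset.sum_filter_add_sum_filter_not s (fun j => i + 2 ≤ j ∨ j + 2 ≤ i)]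
      have h2 : ∑ j ∈ s.filter (fun j => i + 2 ≤ j ∨ j + 2 ≤ i), z j ≤ z i := by
        refine (Finset.sum_le_card_nsmul _ _ _ hfar).trans ?_
        have hc : ((s.filter (fun j => i + 2 ≤ j ∨ j + 2 ≤ i)).card : ℝ) ≤ K :=
          le_trans (by exact_mod_cast Finset.card_filter_le _ _) hs'
        rw [nsmul_eq_mul]
        calc _ ≤ (K : ℝ) * (z i / K) :=
              mul_le_mul_of_nonneg_right hc (div_nonneg (hz i) hK0.le)
          _ = z i := by field_simp
      have h3 : ∑ j ∈ s.filter (fun j => ¬ (i + 2 ≤ j ∨ j + 2 ≤ i)), z j ≤ 3 * z i := by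
        refine (Finset.sum_le_card_nsmul _ _ (z i)
          fun j hj => hmax j (Finset.mem_filter.1 hj).1).trans ?_
        have hsub : s.filter (fun j => ¬ (i + 2 ≤ j ∨ j + 2 ≤ i)) ⊆ Finset.Icc (i - 1) (i + 1) := by
          intro j hj
          have := (Finset.mem_filter.1 hj).2
          rw [Finset.mem_Icc]; omega
        have hc := Finset.card_le_card hsub
        rw [Nat.card_Icc] at hc
        rw [nsmul_eq_mul]
        refine mul_le_mul_of_nonneg_right ?_ (hz i)
        exact_mod_cast hc.trans (by omega)
      linarith
    have h2 : z i ^ 6 ≤ ∑ i ∈ s, z i ^ 6 :=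
      Finset.single_le_sum (f := fun i => z i ^ 6) (fun j _ => by have := hz j; positivity) hi
    calc (∑ i ∈ s, z i) ^ 6 ≤ (4 * z i) ^ 6 := by gcongr
      _ = 4 ^ 6 * z i ^ 6 := by ring
      _ ≤ 4 ^ 6 * ∑ i ∈ s, z i ^ 6 := by gcongr
      _ ≤ _ := le_add_of_nonneg_right (by positivity)
  · push Not at hfar
    obtain ⟨j, hj, hij⟩ := hfar
    have hij' : z i ≤ K * z j := by
      rw [div_lt_iff₀ hK0] at hij
      linarith
    have hzi := hz i
    have hzj := hz j
    have h1 : ∑ j ∈ s, z j ≤ K * z i := by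
      refine (Finset.sum_le_card_nsmul _ _ (z i) hmax).trans ?_
      rw [nsmul_eq_mul]
      exact mul_le_mul_of_nonneg_right hs' (hz i)
    have h2 : z i ^ 3 * z j ^ 3 ≤
        ∑ j ∈ s.filter (fun j => i + 2 ≤ j ∨ j + 2 ≤ i), z i ^ 3 * z j ^ 3 :=
      Finset.single_le_sum (f := fun j => z i ^ 3 * z j ^ 3)
        (fun j _ => by have := hz j; positivity) hj
    have h3 := Finset.single_le_sum (f := fun i =>
      ∑ j ∈ s.filter (fun j => i + 2 ≤ j ∨ j + 2 ≤ i), z i ^ 3 * z j ^ 3) (fun i _ => hB i) hi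
    calc (∑ i ∈ s, z i) ^ 6 ≤ (K * z i) ^ 6 := by gcongr
      _ = (K : ℝ) ^ 6 * z i ^ 3 * z i ^ 3 := by ring
      _ ≤ (K : ℝ) ^ 6 * z i ^ 3 * (K * z j) ^ 3 := by gcongr
      _ = (K : ℝ) ^ 9 * (z i ^ 3 * z j ^ 3) := by ring
      _ ≤ (K : ℝ) ^ 9 * ∑ i ∈ s, ∑ j ∈ s.filter (fun j => i + 2 ≤ j ∨ j + 2 ≤ i),
            z i ^ 3 * z j ^ 3 := by
          gcongr
          exact h2.trans h3
      _ ≤ _ := le_add_of_nonneg_left (by positivity)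

lemma separated_blocks (A : Finset ℕ) {l i j : ℕ} (hl : 1 ≤ l) (h : i + 2 ≤ j ∨ j + 2 ≤ i) :
    Separated l (A.filter (· / l = i)) (A.filter (· / l = j)) := by
  have key : ∀ {i j a b : ℕ}, i + 2 ≤ j → a / l = i → b / l = j → a + l ≤ b := by
    intro i j a b hij ha hb
    have h1 : a < (i + 1) * l := (Nat.div_lt_iff_lt_mul hl).1 (by omega)
    have h2 : (i + 2) * l ≤ b := (Nat.le_div_iff_mul_le hl).1 (by omega)
    linarith
  rcases h with h | h
  · exact Or.inl fun a ha b hb => key h (Finset.mem_filter.1 ha).2 (Finset.mem_filter.1 hb).2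
  · exact Or.inr fun a ha b hb => key h (Finset.mem_filter.1 hb).2 (Finset.mem_filter.1 ha).2

/-- Lowering the exponent of a moment bound. -/
lemma exists_moment_improvement (n : ℕ) {η : ℝ} (hη : 12 ≤ η * n) (hn : ((2 : ℝ) ^ n)⁻¹ ≤ η) :
    ∃ c : ℝ, 0 ≤ c ∧ ∀ {T : Type} [Fintype T] {f : ℕ → ℝ} {e : ℕ → T → ℂ} {G : ℝ},
      IsSystem f e → 0 ≤ G → MomentBound e G (3 + η) →
        MomentBound e (c * G) (3 + η - ((2 : ℝ) ^ n)⁻¹) := by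
  obtain ⟨b, hb, hbil⟩ := exists_mixed_bound n 512 hη
  refine ⟨512 + 4 * 513 ^ 9 * 513 ^ 2 * b, by positivity, ?_⟩
  intro T _ f e G he hG hM
  set C : ℝ := 512 + 4 * 513 ^ 9 * 513 ^ 2 * b with hC
  set lam : ℝ := 3 + η - ((2 : ℝ) ^ n)⁻¹ with hlam
  have hinv : ((2 : ℝ) ^ n)⁻¹ ≤ 1 := inv_le_one_of_one_le₀ (one_le_pow₀ (by norm_num))
  have hlam3 : 3 ≤ lam := by rw [hlam]; linarith
  intro L
  induction L using Nat.strong_induction_on with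
  | _ L ih =>
  intro A hL hA
  have hL1 : (1 : ℝ) ≤ L := by exact_mod_cast hL
  rcases lt_or_ge L 512 with hsmall | hbig
  · have h1 : (L : ℝ) ^ (3 + η) ≤ 512 * (L : ℝ) ^ lam := by
      have h2 : (L : ℝ) ^ (3 + η) = (L : ℝ) ^ (((2 : ℝ) ^ n)⁻¹) * (L : ℝ) ^ lam := by
        rw [← Real.rpow_add (by linarith)]; congr 1; rw [hlam]; ring
      have h3 : (L : ℝ) ^ (((2 : ℝ) ^ n)⁻¹) ≤ 512 := by
        calc (L : ℝ) ^ (((2 : ℝ) ^ n)⁻¹) ≤ (L : ℝ) ^ (1 : ℝ) :=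
              Real.rpow_le_rpow_of_exponent_le hL1 hinv
          _ ≤ 512 := by rw [Real.rpow_one]; exact_mod_cast hsmall.le
      rw [h2]; gcongr
    calc _ ≤ G * (L : ℝ) ^ (3 + η) := hM L A hL hA
      _ ≤ G * (512 * (L : ℝ) ^ lam) := by gcongr
      _ = 512 * (G * (L : ℝ) ^ lam) := by ring
      _ ≤ C * (G * (L : ℝ) ^ lam) := by
          apply mul_le_mul_of_nonneg_right _ (by positivity)
          rw [hC]; linarith [show 0 ≤ 4 * 513 ^ 9 * 513 ^ 2 * b by positivity]
      _ = _ := by ring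
  · obtain ⟨M, hM'⟩ : ∃ M, M = L / 512 + 1 := ⟨_, rfl⟩
    have hM1 : 1 ≤ M := by omega
    have hML : M < L := by omega
    have hLM : L ≤ 512 * M := by omega
    have hM256 : 256 * M ≤ L := by omega
    set s := A.image (· / M) with hs
    have hcard : s.card ≤ 513 := card_blocks_le hM1 (hA.mono hLM)
    have hcardr : (s.card : ℝ) ≤ 513 := by exact_mod_cast hcard
    set F : ℕ → T → ℂ := fun j => expSum e (A.filter (· / M = j)) with hF
    have hnarrow : ∀ i ∈ s, ∑ x, ‖F i x‖ ^ 6 ≤ C * G * ((L : ℝ) ^ lam / 256 ^ 3) := by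
      intro i _
      refine (ih M hML _ hM1 (isWindow_block A hM1 i)).trans ?_
      apply mul_le_mul_of_nonneg_left _ (by positivity)
      have h1 : (M : ℝ) ≤ L / 256 := by
        rw [le_div_iff₀ (by norm_num), mul_comm]; exact_mod_cast hM256
      calc (M : ℝ) ^ lam ≤ (L / 256 : ℝ) ^ lam := by gcongr
        _ = (L : ℝ) ^ lam / 256 ^ lam := Real.div_rpow (by positivity) (by norm_num) _
        _ ≤ (L : ℝ) ^ lam / 256 ^ 3 := by
            gcongr
            calc (256 : ℝ) ^ 3 = 256 ^ (3 : ℝ) := by norm_num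
              _ ≤ 256 ^ lam := Real.rpow_le_rpow_of_exponent_le (by norm_num) hlam3
    have hbroad : ∀ i ∈ s, ∀ j ∈ s.filter (fun j => i + 2 ≤ j ∨ j + 2 ≤ i),
        ∑ x, ‖F i x‖ ^ 3 * ‖F j x‖ ^ 3 ≤ 2 * (b * G * (L : ℝ) ^ lam) := by
      intro i _ j hj
      have hsep := separated_blocks A hM1 (Finset.mem_filter.1 hj).2
      have hi := (isWindow_block A hM1 i).mono hML.le
      have hj := (isWindow_block A hM1 j).mono hML.le
      have h1 := hbil he hG hM hL hM1 hLM hi hj hsep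
      have h2 := hbil he hG hM hL hM1 hLM hj hi hsep.symm
      calc ∑ x, ‖F i x‖ ^ 3 * ‖F j x‖ ^ 3
          ≤ ∑ x, (‖F i x‖ ^ 2 * ‖F j x‖ ^ 4 + ‖F j x‖ ^ 2 * ‖F i x‖ ^ 4) := by
            refine Finset.sum_le_sum fun x _ => ?_
            have : 0 ≤ ‖F i x‖ ^ 2 * ‖F j x‖ ^ 2 := by positivity
            nlinarith [mul_nonneg this (sq_nonneg (‖F i x‖ - ‖F j x‖)),
              mul_nonneg this (sq_nonneg ‖F i x‖), mul_nonneg this (sq_nonneg ‖F j x‖)]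
        _ ≤ _ := by
            rw [Finset.sum_add_distrib, two_mul]
            exact add_le_add h1 h2
    have hpt : ∀ x, ‖expSum e A x‖ ^ 6 ≤ 4 ^ 6 * ∑ i ∈ s, ‖F i x‖ ^ 6 +
        513 ^ 9 * ∑ i ∈ s, ∑ j ∈ s.filter (fun j => i + 2 ≤ j ∨ j + 2 ≤ i),
          ‖F i x‖ ^ 3 * ‖F j x‖ ^ 3 := by
      intro x
      have h1 := sum_pow_six_le (z := fun i => ‖F i x‖) (fun i => norm_nonneg _)
        (by norm_num : 1 ≤ 513) hcard
      refine le_trans ?_ (h1.trans_eq (by norm_num))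
      rw [expSum_eq_sum_blocks e A M x]
      gcongr
      exact norm_sum_le _ _
    have hX : 0 ≤ G * (L : ℝ) ^ lam := by positivity
    calc ∑ x, ‖expSum e A x‖ ^ 6
        ≤ ∑ x, (4 ^ 6 * ∑ i ∈ s, ‖F i x‖ ^ 6 +
            513 ^ 9 * ∑ i ∈ s, ∑ j ∈ s.filter (fun j => i + 2 ≤ j ∨ j + 2 ≤ i),
              ‖F i x‖ ^ 3 * ‖F j x‖ ^ 3) := Finset.sum_le_sum fun x _ => hpt x
      _ = 4 ^ 6 * ∑ i ∈ s, ∑ x, ‖F i x‖ ^ 6 +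
            513 ^ 9 * ∑ i ∈ s, ∑ j ∈ s.filter (fun j => i + 2 ≤ j ∨ j + 2 ≤ i),
              ∑ x, ‖F i x‖ ^ 3 * ‖F j x‖ ^ 3 := by
          rw [Finset.sum_add_distrib, ← Finset.mul_sum, ← Finset.mul_sum, Finset.sum_comm]
          congr 2
          rw [Finset.sum_comm]
          exact Finset.sum_congr rfl fun i _ => Finset.sum_comm
      _ ≤ 4 ^ 6 * ∑ i ∈ s, C * G * ((L : ℝ) ^ lam / 256 ^ 3) +
            513 ^ 9 * ∑ i ∈ s, 513 * (2 * (b * G * (L : ℝ) ^ lam)) := by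
          gcongr with i hi i hi
          · exact hnarrow i hi
          · refine (Finset.sum_le_card_nsmul _ _ _ (hbroad i hi)).trans ?_
            rw [nsmul_eq_mul]
            apply mul_le_mul_of_nonneg_right _ (by positivity)
            exact le_trans (by exact_mod_cast Finset.card_filter_le _ _) hcardr
      _ ≤ 4 ^ 6 * (513 * (C * G * ((L : ℝ) ^ lam / 256 ^ 3))) +
            513 ^ 9 * (513 * (513 * (2 * (b * G * (L : ℝ) ^ lam)))) := by
          rw [Finset.sum_const, Finset.sum_const, nsmul_eq_mul, nsmul_eq_mul]
          gcongr
      _ = (4 ^ 6 * 513 / 256 ^ 3 * C + 2 * 513 ^ 9 * 513 ^ 2 * b) * (G * (L : ℝ) ^ lam) := by ring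
      _ ≤ C * (G * (L : ℝ) ^ lam) := by
          apply mul_le_mul_of_nonneg_right _ hX
          rw [hC]
          linarith [show 0 ≤ 513 ^ 9 * 513 ^ 2 * b by positivity]
      _ = _ := by ring

lemma IsSystem.trivial_bound {T : Type} [Fintype T] {f : ℕ → ℝ} {e : ℕ → T → ℂ}
    (he : IsSystem f e) : MomentBound e (Fintype.card T) 6 := by
  rintro L A - ⟨u, hu⟩
  have hcard : A.card ≤ L := by simpa using Finset.card_le_card hu
  have h1 : ∀ x, ‖expSum e A x‖ ^ 6 ≤ (L : ℝ) ^ 6 := by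
    intro x
    gcongr
    calc ‖expSum e A x‖ ≤ ∑ n ∈ A, ‖e n x‖ := norm_sum_le _ _
      _ ≤ ∑ n ∈ A, 1 := Finset.sum_le_sum fun n _ => he.norm_le n x
      _ ≤ L := by simpa using hcard
  calc _ ≤ ∑ x : T, (L : ℝ) ^ 6 := Finset.sum_le_sum fun x _ => h1 x
    _ = _ := by
      rw [Finset.sum_const, nsmul_eq_mul, Finset.card_univ]
      norm_num

/-- Sixth moments over windows obey square-root cancellation up to an arbitrarily small power. -/
theorem exists_moment_bound {ε : ℝ} (hε : 0 < ε) : ∃ C : ℝ, 0 ≤ C ∧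
    ∀ {T : Type} [Fintype T] {f : ℕ → ℝ} {e : ℕ → T → ℂ},
      IsSystem f e → MomentBound e (C * Fintype.card T) (3 + ε) := by
  obtain ⟨n, hn⟩ := exists_nat_ge (12 / ε)
  rw [div_le_iff₀ hε] at hn
  set δ : ℝ := ((2 : ℝ) ^ n)⁻¹ with hδ
  have hδ0 : 0 < δ := by positivity
  have hδε : δ ≤ ε := by
    have h1 : (n : ℝ) ≤ 2 ^ n := by exact_mod_cast n.lt_two_pow_self.le
    rw [hδ, inv_le_iff_one_le_mul₀ (by positivity)]
    nlinarith
  have key : ∀ j : ℕ, ∃ C : ℝ, 0 ≤ C ∧ ∀ {T : Type} [Fintype T] {f : ℕ → ℝ} {e : ℕ → T → ℂ},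
      IsSystem f e → MomentBound e (C * Fintype.card T) (max (6 - j * δ) (3 + ε)) := by
    have hmono : ∀ {T : Type} [Fintype T] {e : ℕ → T → ℂ} {G lam lam' : ℝ}, 0 ≤ G → lam ≤ lam' →
        MomentBound e G lam → MomentBound e G lam' := by
      intro T _ e G lam lam' hG hl h L A hL hA
      refine (h L A hL hA).trans ?_
      gcongr
      exact_mod_cast hL
    intro j
    induction j with
    | zero =>
      refine ⟨1, zero_le_one, fun he => ?_⟩
      rw [one_mul]
      exact hmono (by positivity) (by simp) he.trivial_bound
    | succ j ih =>
      obtain ⟨C, hC, h⟩ := ih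
      rcases le_total (6 - j * δ) (3 + ε) with hj | hj
      · refine ⟨C, hC, fun he => hmono (by positivity) ?_ (h he)⟩
        rw [max_eq_right hj]
        exact le_max_right _ _
      · rw [max_eq_left hj] at h
        have hη : ε ≤ 3 - j * δ := by linarith
        have hn' : 12 ≤ (3 - j * δ) * n := by nlinarith [(Nat.cast_nonneg n : (0 : ℝ) ≤ n)]
        obtain ⟨c, hc, himp⟩ := exists_moment_improvement n hn' (hδε.trans hη)
        refine ⟨c * C, by positivity, fun he => ?_⟩
        have h1 := h he
        rw [show 6 - j * δ = 3 + (3 - j * δ) by ring] at h1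
        have h2 := himp he (by positivity) h1
        rw [mul_assoc]
        refine hmono (by positivity) (le_trans (le_of_eq ?_) (le_max_left _ _)) h2
        push_cast
        ring
  obtain ⟨j, hj⟩ := exists_nat_ge (3 / δ)
  rw [div_le_iff₀ hδ0] at hj
  obtain ⟨C, hC, h⟩ := key j
  rw [max_eq_right (by linarith)] at h
  exact ⟨C, hC, h⟩

/-! ### A finite model of the exponential sums -/

lemma int_eq_zero_of_cast {M : ℕ} {s : ℤ} (h : (s : ZMod M) = 0) (hs : |s| < M) : s = 0 :=
  Int.eq_zero_of_abs_lt_dvd ((ZMod.intCast_zmod_eq_zero_iff_dvd s M).1 h) hs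

section Model

variable {M : ℕ} [NeZero M]

/-- The character of `(ℤ/M)²` with frequency `v`. -/
noncomputable def planeChar (v x : ZMod M × ZMod M) : ℂ :=
  ZMod.stdAddChar (x.1 * v.1 + x.2 * v.2)

lemma planeChar_add (v w x : ZMod M × ZMod M) :
    planeChar (v + w) x = planeChar v x * planeChar w x := by
  rw [planeChar, planeChar, planeChar, ← AddChar.map_add_eq_mul]
  congr 1
  simp only [Prod.fst_add, Prod.snd_add]
  ring

lemma conj_planeChar (v x : ZMod M × ZMod M) : conj (planeChar v x) = planeChar (-v) x := by
  rw [planeChar, planeChar, ← AddChar.map_neg_eq_conj]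
  congr 1
  simp only [Prod.fst_neg, Prod.snd_neg]
  ring

lemma norm_planeChar (v x : ZMod M × ZMod M) : ‖planeChar v x‖ = 1 :=
  AddChar.norm_apply _ _

lemma sum_planeChar (v : ZMod M × ZMod M) :
    ∑ x, planeChar v x = if v = 0 then (M : ℂ) ^ 2 else 0 := by
  have hψ := ZMod.isPrimitive_stdAddChar M
  have h : ∑ x, planeChar v x =
      (∑ a : ZMod M, ZMod.stdAddChar (a * v.1)) * ∑ b : ZMod M, ZMod.stdAddChar (b * v.2) := by
    rw [Fintype.sum_prod_type, Finset.sum_mul_sum]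
    refine Finset.sum_congr rfl fun a _ => Finset.sum_congr rfl fun b _ => ?_
    rw [planeChar, AddChar.map_add_eq_mul]
  rw [h, AddChar.sum_mulShift _ hψ, AddChar.sum_mulShift _ hψ, ZMod.card]
  by_cases h1 : v.1 = 0 <;> by_cases h2 : v.2 = 0 <;> simp [h1, h2, Prod.ext_iff, sq]

/-- The point `(n, ⌊f n⌋)` modulo `M`. -/
noncomputable def curvePoint (M : ℕ) (f : ℕ → ℝ) (n : ℕ) : ZMod M × ZMod M :=
  (((n : ℤ) : ZMod M), ((⌊f n⌋ : ℤ) : ZMod M))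

/-- Characters at the points `(n, ⌊f n⌋)` with `n < W`. -/
noncomputable def curveChar (M : ℕ) [NeZero M] (f : ℕ → ℝ) (W n : ℕ) (x : ZMod M × ZMod M) : ℂ :=
  if n < W then planeChar (curvePoint M f n) x else 0

lemma isSystem_curveChar {f : ℕ → ℝ} (hf : IsConvexSeq f) {W b : ℕ}
    (hb : ∀ n < W, (n : ℤ) ≤ b ∧ |⌊f n⌋| ≤ b) (hM : 6 * b < M) :
    IsSystem f (curveChar M f W) where
  convex := hf
  norm_le n x := by
    rw [curveChar]
    split_ifs
    · exact (norm_planeChar _ _).le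
    · simp
  orth n₁ n₂ n₃ n₄ n₅ n₆ h := by
    have hlt : n₁ < W ∧ n₂ < W ∧ n₃ < W ∧ n₄ < W ∧ n₅ < W ∧ n₆ < W := by
      refine ⟨?_, ?_, ?_, ?_, ?_, ?_⟩ <;>
      · by_contra hn
        refine h (Finset.sum_eq_zero fun x _ => ?_)
        simp only [curveChar, if_neg hn, map_zero, mul_zero, zero_mul]
    obtain ⟨h₁, h₂, h₃, h₄, h₅, h₆⟩ := hlt
    simp only [curveChar, h₁, h₂, h₃, h₄, h₅, h₆, if_true, conj_planeChar, ← planeChar_add,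
      sum_planeChar] at h
    have hv := (ite_ne_right_iff.1 h).1
    have hv1 := congrArg Prod.fst hv
    have hv2 := congrArg Prod.snd hv
    simp only [curvePoint, Prod.fst_add, Prod.snd_add, Prod.fst_neg, Prod.snd_neg, Prod.fst_zero,
      Prod.snd_zero, ← Int.cast_add, ← Int.cast_neg] at hv1 hv2
    have k₁ := hb _ h₁
    have k₂ := hb _ h₂
    have k₃ := hb _ h₃
    have k₄ := hb _ h₄
    have k₅ := hb _ h₅
    have k₆ := hb _ h₆
    simp only [abs_le] at k₁ k₂ k₃ k₄ k₅ k₆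
    have e1 := int_eq_zero_of_cast hv1 (by rw [abs_lt]; omega)
    have e2 := int_eq_zero_of_cast hv2 (by rw [abs_lt]; omega)
    refine ⟨by omega, ?_⟩
    have e2' : (⌊f n₁⌋ + ⌊f n₂⌋ + ⌊f n₃⌋ + -⌊f n₄⌋ + -⌊f n₅⌋ + -⌊f n₆⌋ : ℝ) = 0 := by
      exact_mod_cast e2
    have fl : ∀ n, (⌊f n⌋ : ℝ) ≤ f n ∧ f n ≤ ⌊f n⌋ + 1 :=
      fun n => ⟨Int.floor_le _, (Int.lt_floor_add_one _).le⟩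
    rw [abs_le]
    constructor <;> linarith [(fl n₁).1, (fl n₂).1, (fl n₃).1, (fl n₄).1, (fl n₅).1, (fl n₆).1,
      (fl n₁).2, (fl n₂).2, (fl n₃).2, (fl n₄).2, (fl n₅).2, (fl n₆).2]

/-- Sextuples from `[1, R]` with prescribed alternating sums of `n` and `⌊f n⌋`. -/
noncomputable def sextuples (f : ℕ → ℝ) (R : ℕ) (σ τ : ℤ) : Finset (Fin 6 → ℕ) :=
  (Fintype.piFinset fun _ : Fin 6 => Finset.Icc 1 R).filter fun t =>
    (t 0 : ℤ) + t 1 + t 2 - (t 3 + t 4 + t 5) = σ ∧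
      ⌊f (t 0)⌋ + ⌊f (t 1)⌋ + ⌊f (t 2)⌋ - (⌊f (t 3)⌋ + ⌊f (t 4)⌋ + ⌊f (t 5)⌋) = τ

lemma card_sextuples_mul_le (f : ℕ → ℝ) {R W : ℕ} (hR : R < W) (σ τ : ℤ) :
    ((sextuples f R σ τ).card : ℝ) * (M : ℝ) ^ 2 ≤
      ∑ x, ‖expSum (curveChar M f W) (Finset.Icc 1 R) x‖ ^ 6 := by
  set w : ZMod M × ZMod M := ((σ : ZMod M), (τ : ZMod M)) with hw
  set g : ZMod M × ZMod M → Fin 6 → ℕ → ℂ := fun x i n =>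
    if i.1 < 3 then curveChar M f W n x else conj (curveChar M f W n x) with hg
  have hnorm : ∀ x, ‖(∏ i, ∑ n ∈ Finset.Icc 1 R, g x i n) * planeChar (-w) x‖ =
      ‖expSum (curveChar M f W) (Finset.Icc 1 R) x‖ ^ 6 := by
    intro x
    rw [norm_mul, norm_planeChar, mul_one, norm_prod]
    have : ∀ i : Fin 6, ‖∑ n ∈ Finset.Icc 1 R, g x i n‖ =
        ‖expSum (curveChar M f W) (Finset.Icc 1 R) x‖ := by
      intro i
      simp only [hg, expSum]
      split_ifs
      · rfl
      · rw [← map_sum, RCLike.norm_conj]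
    rw [Finset.prod_congr rfl fun i _ => this i, Finset.prod_const, Finset.card_univ,
      Fintype.card_fin]
  set v : (Fin 6 → ℕ) → ZMod M × ZMod M := fun t =>
    curvePoint M f (t 0) + curvePoint M f (t 1) + curvePoint M f (t 2) +
      -curvePoint M f (t 3) + -curvePoint M f (t 4) + -curvePoint M f (t 5) + -w with hv
  have hexp : ∑ x, (∏ i, ∑ n ∈ Finset.Icc 1 R, g x i n) * planeChar (-w) x =
      ∑ t ∈ Fintype.piFinset fun _ : Fin 6 => Finset.Icc 1 R,
        if v t = 0 then (M : ℂ) ^ 2 else 0 := by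
    simp_rw [Finset.prod_univ_sum, Finset.sum_mul]
    rw [Finset.sum_comm]
    refine Finset.sum_congr rfl fun t ht => ?_
    rw [← sum_planeChar]
    refine Finset.sum_congr rfl fun x _ => ?_
    have hlt : ∀ i, t i < W := fun i =>
      (Finset.mem_Icc.1 (Fintype.mem_piFinset.1 ht i)).2.trans_lt hR
    rw [Fin.prod_univ_six]
    simp only [hg, hv, curveChar, hlt, if_true, conj_planeChar, planeChar_add]
    rfl
  have hle : ((sextuples f R σ τ).card : ℝ) * (M : ℝ) ^ 2 ≤
      ∑ t ∈ Fintype.piFinset fun _ : Fin 6 => Finset.Icc 1 R,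
        if v t = 0 then (M : ℝ) ^ 2 else 0 := by
    rw [← nsmul_eq_mul, ← Finset.sum_const, sextuples, Finset.sum_filter]
    refine Finset.sum_le_sum fun t _ => ?_
    split_ifs with h1 h2
    · exact le_rfl
    · refine absurd ?_ h2
      obtain ⟨rfl, rfl⟩ := h1
      simp only [hv, hw, curvePoint, Prod.ext_iff, Prod.fst_add, Prod.snd_add, Prod.fst_neg,
        Prod.snd_neg, Prod.fst_zero, Prod.snd_zero]
      push_cast
      constructor <;> ring
    · positivity
    · exact le_rfl
  refine hle.trans ?_
  have hcast : ((∑ t ∈ Fintype.piFinset fun _ : Fin 6 => Finset.Icc 1 R,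
      if v t = 0 then (M : ℝ) ^ 2 else 0 : ℝ) : ℂ) =
        ∑ x, (∏ i, ∑ n ∈ Finset.Icc 1 R, g x i n) * planeChar (-w) x := by
    rw [hexp, Complex.ofReal_sum]
    refine Finset.sum_congr rfl fun t _ => ?_
    split_ifs <;> simp
  calc _ ≤ ‖((∑ t ∈ Fintype.piFinset fun _ : Fin 6 => Finset.Icc 1 R,
        if v t = 0 then (M : ℝ) ^ 2 else 0 : ℝ) : ℂ)‖ := by
        rw [Complex.norm_real]; exact Real.le_norm_self _
    _ ≤ _ := by
        rw [hcast]
        exact (norm_sum_le _ _).trans_eq (Finset.sum_congr rfl fun x _ => hnorm x)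

end Model

theorem exists_card_sextuples_le {ε : ℝ} (hε : 0 < ε) : ∃ C : ℝ, 0 ≤ C ∧
    ∀ {f : ℕ → ℝ}, IsConvexSeq f → ∀ {R : ℕ}, 1 ≤ R → ∀ σ τ : ℤ,
      ((sextuples f R σ τ).card : ℝ) ≤ C * (R : ℝ) ^ (3 + ε) := by
  obtain ⟨C, hC, h⟩ := exists_moment_bound hε
  refine ⟨C, hC, fun {f} hf {R} hR σ τ => ?_⟩
  set b : ℕ := R + ∑ n ∈ Finset.range (R + 1), (⌊f n⌋).natAbs with hb
  have hbound : ∀ n < R + 1, (n : ℤ) ≤ b ∧ |⌊f n⌋| ≤ b := by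
    intro n hn
    have h1 : (⌊f n⌋).natAbs ≤ ∑ n ∈ Finset.range (R + 1), (⌊f n⌋).natAbs :=
      Finset.single_le_sum (f := fun n => (⌊f n⌋).natAbs) (fun _ _ => Nat.zero_le _)
        (Finset.mem_range.2 hn)
    rw [Int.abs_eq_natAbs]
    omega
  have hsys := isSystem_curveChar (M := 6 * b + 1) hf hbound (by omega)
  have h1 := card_sextuples_mul_le (M := 6 * b + 1) f (Nat.lt_succ_self R) σ τ
  have h2 := h hsys R (Finset.Icc 1 R) hR ⟨1, fun n hn => by
    rw [Finset.mem_Icc] at hn; rw [Finset.mem_Ico]; omega⟩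
  have hcard : (Fintype.card (ZMod (6 * b + 1) × ZMod (6 * b + 1)) : ℝ) =
      ((6 * b + 1 : ℕ) : ℝ) ^ 2 := by
    rw [Fintype.card_prod, ZMod.card]; push_cast; ring
  rw [hcard] at h2
  have hpos : (0 : ℝ) < ((6 * b + 1 : ℕ) : ℝ) ^ 2 := by positivity
  refine le_of_mul_le_mul_right ?_ hpos
  refine h1.trans (h2.trans_eq (by ring))

/-! ### Generalized Dirichlet sequences -/

/-- A finite sequence with second differences in `[1/4, 4]` is the sum of an affine function and
an infinite such sequence that vanishes at `0` and `1`. -/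
lemma exists_convex_extension (F : ℕ → ℝ) (R : ℕ)
    (hF : ∀ i, 1 ≤ i → i + 2 ≤ R →
      F (i + 2) - F (i + 1) - (F (i + 1) - F i) ∈ Set.Icc (1 / 4 : ℝ) 4) :
    ∃ f, IsConvexSeq f ∧ f 0 = 0 ∧ f 1 = 0 ∧
      ∀ n, 1 ≤ n → n ≤ R → F n = F 1 + (n - 1) * (F 2 - F 1 - 1 / 4) + f n := by
  set s : ℕ → ℝ := fun i => if 1 ≤ i ∧ i + 2 ≤ R then
    F (i + 2) - F (i + 1) - (F (i + 1) - F i) else 1 / 4 with hs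
  set f : ℕ → ℝ := fun n => ∑ i ∈ Finset.range n, ∑ j ∈ Finset.range i, s j with hf
  have hdiff : ∀ n, f (n + 2) - f (n + 1) - (f (n + 1) - f n) = s n := by
    intro n
    simp only [hf, Finset.sum_range_succ]
    ring
  have h0 : f 0 = 0 := by simp [hf]
  have h1 : f 1 = 0 := by simp [hf]
  have h2 : f 2 = 1 / 4 := by
    have := hdiff 0
    simp only [zero_add, h0, h1] at this
    simpa [hs] using this
  refine ⟨f, fun n => ?_, h0, h1, ?_⟩
  · rw [hdiff]
    simp only [hs]
    split_ifs with h
    · exact hF n h.1 h.2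
    · norm_num
  · have key : ∀ n, (n + 1 ≤ R → F (n + 1) = F 1 + n * (F 2 - F 1 - 1 / 4) + f (n + 1)) ∧
        (n + 2 ≤ R → F (n + 2) = F 1 + (n + 1) * (F 2 - F 1 - 1 / 4) + f (n + 2)) := by
      intro n
      induction n with
      | zero =>
        simp only [zero_add, h1, h2, Nat.cast_zero]
        exact ⟨fun _ => by ring, fun _ => by ring⟩
      | succ n ih =>
        refine ⟨fun h => by push_cast; exact ih.2 h, fun h => ?_⟩
        have a1 := ih.1 (by omega)
        have a2 := ih.2 (by omega)
        have a3 := hdiff (n + 1)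
        simp only [hs] at a3
        rw [if_pos ⟨by omega, h⟩] at a3
        push_cast
        linarith
    intro n hn hnR
    obtain ⟨m, rfl⟩ := Nat.exists_eq_add_of_le' hn
    have := (key m).1 hnR
    push_cast
    rw [add_sub_cancel_right]
    exact this

lemma exists_sextuples_cover {N R : ℕ} {θ : ℝ} {a : ℕ → ℝ} (hN : 2 ≤ N)
    (hR : (R : ℝ) = Real.sqrt N) (hθ : 0 < θ) (hθ1 : θ ≤ 1) (ha : ShortGDS N R θ a) :
    ∃ f, IsConvexSeq f ∧ ∃ c : ℤ → ℤ, {t : Fin 6 → ℕ | (∀ i, 1 ≤ t i ∧ t i ≤ R) ∧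
        |(a (t 0) + a (t 1) + a (t 2)) - (a (t 3) + a (t 4) + a (t 5))| ≤ θ / (N : ℝ) ^ 2} ⊆
      ((Finset.Icc (-104 : ℤ) 104 ×ˢ Finset.Icc (-4 : ℤ) 5).biUnion fun p =>
        sextuples f R p.1 (c p.1 + p.2) : Finset (Fin 6 → ℕ)) := by
  have hN2 : (2 : ℝ) ≤ N := by exact_mod_cast hN
  have hN0 : (0 : ℝ) < N := by linarith
  set μ : ℝ := (N : ℝ) ^ 2 / θ with hμ
  have hμ0 : 0 < μ := by positivity
  have hμθ : μ * (θ / (N : ℝ) ^ 2) = 1 := by rw [hμ]; field_simp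
  obtain ⟨f, hf, hf0, hf1, hrep⟩ := exists_convex_extension (fun n => μ * a n) R (by
    intro i hi hiR
    have h := ha.2 i hi hiR
    rw [Set.mem_Icc] at h ⊢
    have h1 := mul_le_mul_of_nonneg_left h.1 hμ0.le
    have h2 := mul_le_mul_of_nonneg_left h.2 hμ0.le
    have e1 : μ * (θ / (4 * (N : ℝ) ^ 2)) = 1 / 4 := by rw [hμ]; field_simp
    have e2 : μ * (4 * θ / (N : ℝ) ^ 2) = 4 := by rw [hμ]; field_simp
    constructor <;> linarith)
  set c : ℝ := μ * a 2 - μ * a 1 - 1 / 4 with hc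
  have hcN : (N : ℝ) / 8 ≤ c := by
    have h1 := mul_le_mul_of_nonneg_left ha.1.1 hμ0.le
    have e1 : μ * (1 / (4 * (N : ℝ))) = N / 4 / θ := by rw [hμ]; field_simp
    have h2 : (N : ℝ) / 4 ≤ N / 4 / θ := by
      rw [le_div_iff₀ hθ]
      nlinarith
    rw [hc]
    linarith
  refine ⟨f, hf, fun σ => ⌊-(c * σ)⌋, fun t htmem => ?_⟩
  have ht := htmem.1
  have hsum := htmem.2
  have hfb : ∀ n, n ≤ R → 0 ≤ f n ∧ f n ≤ 4 * N := by
    intro n hn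
    have h := hf.tangent 0 n
    simp only [zero_add, hf0, hf1, sub_zero, mul_zero, Set.mem_Icc] at h
    refine ⟨h.1, h.2.trans ?_⟩
    have h1 : (n : ℝ) ≤ R := by exact_mod_cast hn
    have h2 : (R : ℝ) ^ 2 = N := by rw [hR, Real.sq_sqrt hN0.le]
    rw [← h2]; gcongr
  set σ : ℤ := (t 0 : ℤ) + t 1 + t 2 - (t 3 + t 4 + t 5) with hσ
  set τ : ℤ := ⌊f (t 0)⌋ + ⌊f (t 1)⌋ + ⌊f (t 2)⌋ - (⌊f (t 3)⌋ + ⌊f (t 4)⌋ + ⌊f (t 5)⌋) with hτ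
  have hσr : (σ : ℝ) = (t 0 : ℝ) + t 1 + t 2 - (t 3 + t 4 + t 5) := by rw [hσ]; push_cast; rfl
  have hτr : (τ : ℝ) = (⌊f (t 0)⌋ : ℝ) + ⌊f (t 1)⌋ + ⌊f (t 2)⌋ -
      (⌊f (t 3)⌋ + ⌊f (t 4)⌋ + ⌊f (t 5)⌋) := by rw [hτ]; push_cast; rfl
  have hb : ∀ i, 0 ≤ f (t i) ∧ f (t i) ≤ 4 * N := fun i => hfb _ (ht i).2
  have hr : ∀ i, μ * a (t i) = μ * a 1 + (t i - 1) * c + f (t i) :=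
    fun i => hrep _ (ht i).1 (ht i).2
  have fl : ∀ i, (⌊f (t i)⌋ : ℝ) ≤ f (t i) ∧ f (t i) < ⌊f (t i)⌋ + 1 :=
    fun i => ⟨Int.floor_le _, Int.lt_floor_add_one _⟩
  have hkey : |f (t 0) + f (t 1) + f (t 2) - (f (t 3) + f (t 4) + f (t 5)) + c * σ| ≤ 1 := by
    have h1 := mul_le_mul_of_nonneg_left hsum hμ0.le
    rw [hμθ, ← abs_of_pos hμ0, ← abs_mul] at h1
    refine le_of_eq_of_le (congrArg _ ?_) h1
    rw [hσr]
    linear_combination -(hr 0) - hr 1 - hr 2 + hr 3 + hr 4 + hr 5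
  rw [abs_le] at hkey
  have hσb : -104 ≤ σ ∧ σ ≤ 104 := by
    have h1 := hb 0
    have h2 := hb 1
    have h3 := hb 2
    have h4 := hb 3
    have h5 := hb 4
    have h6 := hb 5
    have u1 : c * σ ≤ 13 * N := by linarith
    have u2 : -(13 * N) ≤ c * σ := by linarith
    constructor
    · by_contra hlt
      have : (σ : ℝ) ≤ -105 := by exact_mod_cast (by omega : σ ≤ -105)
      nlinarith
    · by_contra hlt
      have : (105 : ℝ) ≤ σ := by exact_mod_cast (by omega : 105 ≤ σ)
      nlinarith
  have hτb : -4 ≤ τ - ⌊-(c * σ)⌋ ∧ τ - ⌊-(c * σ)⌋ ≤ 5 := by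
    have g1 := Int.floor_le (-(c * σ))
    have g2 := Int.lt_floor_add_one (-(c * σ))
    have h1 := fl 0
    have h2 := fl 1
    have h3 := fl 2
    have h4 := fl 3
    have h5 := fl 4
    have h6 := fl 5
    constructor
    · have : (-4 : ℝ) ≤ ((τ - ⌊-(c * σ)⌋ : ℤ) : ℝ) := by push_cast; linarith
      exact_mod_cast this
    · have : ((τ - ⌊-(c * σ)⌋ : ℤ) : ℝ) ≤ 5 := by push_cast; linarith
      exact_mod_cast this
  rw [Finset.mem_coe, Finset.mem_biUnion]
  refine ⟨(σ, τ - ⌊-(c * σ)⌋), ?_, ?_⟩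
  · rw [Finset.mem_product, Finset.mem_Icc, Finset.mem_Icc]
    exact ⟨hσb, hτb⟩
  · rw [sextuples, Finset.mem_filter, Fintype.mem_piFinset]
    refine ⟨fun i => Finset.mem_Icc.2 (ht i), rfl, ?_⟩
    simp only [add_sub_cancel]
    rfl

end ShortDirichlet

/-- the number of approximate solutions to
`a_{n₁}+a_{n₂}+a_{n₃} = a_{n₄}+a_{n₅}+a_{n₆}` (up to error `θ/N²`) for a short
generalized Dirichlet sequence is at most `C_ε log^C(θ⁻¹+1) N^{3/2+ε}`. -/
theorem count_additive_sextuples :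
    ∃ C : ℝ, 0 < C ∧ ∀ ε : ℝ, 0 < ε → ∃ Cε : ℝ, 0 < Cε ∧
      ∀ (N R : ℕ) (θ : ℝ) (a : ℕ → ℝ),
        2 ≤ N → (R : ℝ) = Real.sqrt N → 0 < θ → θ ≤ 1 →
        ShortGDS N R θ a →
        (Set.ncard {t : Fin 6 → ℕ |
            (∀ i, 1 ≤ t i ∧ t i ≤ R) ∧
            |(a (t 0) + a (t 1) + a (t 2)) - (a (t 3) + a (t 4) + a (t 5))| ≤
              θ / (N : ℝ) ^ 2} : ℝ) ≤
          Cε * Real.log (θ⁻¹ + 1) ^ C * (N : ℝ) ^ ((3 : ℝ) / 2 + ε) := by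
  refine ⟨1, one_pos, fun ε hε => ?_⟩
  obtain ⟨C, hC, hcount⟩ := ShortDirichlet.exists_card_sextuples_le (mul_pos two_pos hε)
  have hlog2 : 0 < Real.log 2 := Real.log_pos one_lt_two
  refine ⟨(2090 * C + 1) / Real.log 2, by positivity, ?_⟩
  intro N R θ a hN hR hθ hθ1 ha
  have hN2 : (2 : ℝ) ≤ N := by exact_mod_cast hN
  have hN0 : (0 : ℝ) ≤ N := by linarith
  obtain ⟨f, hf, c, hsub⟩ := ShortDirichlet.exists_sextuples_cover hN hR hθ hθ1 ha
  have hR1 : 1 ≤ R := by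
    have : (0 : ℝ) < R := by rw [hR]; exact Real.sqrt_pos.2 (by linarith)
    exact_mod_cast this
  have hpow : (R : ℝ) ^ (3 + 2 * ε) = (N : ℝ) ^ ((3 : ℝ) / 2 + ε) := by
    rw [hR, Real.sqrt_eq_rpow, ← Real.rpow_mul hN0]
    congr 1
    ring
  have hX : 0 ≤ (N : ℝ) ^ ((3 : ℝ) / 2 + ε) := by positivity
  have hlog : Real.log 2 ≤ Real.log (θ⁻¹ + 1) := by
    apply Real.log_le_log two_pos
    have := (one_le_inv₀ hθ).2 hθ1
    linarith
  have hcard : (Set.ncard {t : Fin 6 → ℕ | (∀ i, 1 ≤ t i ∧ t i ≤ R) ∧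
      |(a (t 0) + a (t 1) + a (t 2)) - (a (t 3) + a (t 4) + a (t 5))| ≤ θ / (N : ℝ) ^ 2} : ℝ) ≤
        2090 * C * (N : ℝ) ^ ((3 : ℝ) / 2 + ε) := by
    have h1 := Set.ncard_le_ncard hsub (Finset.finite_toSet _)
    rw [Set.ncard_coe_finset] at h1
    have h2 := h1.trans Finset.card_biUnion_le
    calc _ ≤ ((∑ p ∈ Finset.Icc (-104 : ℤ) 104 ×ˢ Finset.Icc (-4 : ℤ) 5,
          (ShortDirichlet.sextuples f R p.1 (c p.1 + p.2)).card : ℕ) : ℝ) := by exact_mod_cast h2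
      _ ≤ ∑ p ∈ Finset.Icc (-104 : ℤ) 104 ×ˢ Finset.Icc (-4 : ℤ) 5,
          C * (R : ℝ) ^ (3 + 2 * ε) := by
          push_cast
          exact Finset.sum_le_sum fun p _ => hcount hf hR1 _ _
      _ = _ := by
          have hbox : (Finset.Icc (-104 : ℤ) 104 ×ˢ Finset.Icc (-4 : ℤ) 5).card = 2090 := by
            rw [Finset.card_product, Int.card_Icc, Int.card_Icc]
            rfl
          rw [Finset.sum_const, hbox, nsmul_eq_mul, hpow]
          push_cast
          ring
  calc _ ≤ 2090 * C * (N : ℝ) ^ ((3 : ℝ) / 2 + ε) := hcard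
    _ ≤ (2090 * C + 1) * (N : ℝ) ^ ((3 : ℝ) / 2 + ε) := by gcongr; linarith
    _ = (2090 * C + 1) / Real.log 2 * Real.log 2 * (N : ℝ) ^ ((3 : ℝ) / 2 + ε) := by
        rw [div_mul_cancel₀ _ hlog2.ne']
    _ ≤ _ := by
        rw [Real.rpow_one]
        gcongr
end

section
/- For every constant A > 0 and every ε > 0 there exists C_{ε,A} > 0 such that for every integer N ≥ 2, the number of 6-tuples of integers (n₁,…,n₆) with N + 1 ≤ n_i ≤ N + N^{1/2} for all i and |n₁n₂n₃ − n₄n₅n₆| ≤ A·N is at most C_{ε,A} N^{3/2+ε}. -/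
open Finset ComplexConjugate

section Moments

variable {V : Type*} [AddCommGroup V]

/-- The exponential sum `χ ↦ ∑ a ∈ s, χ (v a)` over the dual group of `V`. -/
noncomputable def expSum (v : ℕ → V) (s : Finset ℕ) (χ : AddChar V ℂ) : ℂ :=
  ∑ a ∈ s, χ (v a)

theorem expSum_mul_mul (v : ℕ → V) (s t u : Finset ℕ) (χ : AddChar V ℂ) :
    expSum v s χ * expSum v t χ * expSum v u χ =
      ∑ p ∈ s ×ˢ t ×ˢ u, χ (v p.1 + v p.2.1 + v p.2.2) := by
  simp only [expSum, χ.map_add_eq_mul, sum_product, ← mul_sum, ← sum_mul]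

/-- The part of `S` in the `j`-th interval `[j * 256 ^ k, (j + 1) * 256 ^ k)`. -/
def block (S : Finset ℕ) (k j : ℕ) : Finset ℕ := S.filter fun a => a / 256 ^ k = j

/-- The indices of the blocks `l` levels below that make up the `j`-th block. -/
def children (l j : ℕ) : Finset ℕ := Ico (j * 256 ^ l) ((j + 1) * 256 ^ l)

theorem card_children (l j : ℕ) : #(children l j) = 256 ^ l := by
  rw [children, Nat.card_Ico, add_mul, one_mul, Nat.add_sub_cancel_left]

theorem mem_block {S : Finset ℕ} {k j a : ℕ} :
    a ∈ block S k j ↔ a ∈ S ∧ j * 256 ^ k ≤ a ∧ a < (j + 1) * 256 ^ k := by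
  have h : 0 < 256 ^ k := by positivity
  rw [block, mem_filter, Nat.div_eq_iff h, add_mul, one_mul,
    Nat.le_sub_one_iff_lt (by positivity)]

/-- All elements of one set exceed all elements of the other by at least `s`. -/
def Separated (s : ℕ) (I J : Finset ℕ) : Prop :=
  (∀ a ∈ I, ∀ b ∈ J, b + s ≤ a) ∨ ∀ a ∈ I, ∀ b ∈ J, a + s ≤ b

theorem Separated.mono {s : ℕ} {I J I' J' : Finset ℕ} (h : Separated s I J) (hI : I' ⊆ I)
    (hJ : J' ⊆ J) : Separated s I' J' :=
  h.imp (fun h a ha b hb => h a (hI ha) b (hJ hb)) fun h a ha b hb => h a (hI ha) b (hJ hb)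

theorem Separated.symm {s : ℕ} {I J : Finset ℕ} (h : Separated s I J) : Separated s J I :=
  (Or.symm h).imp (fun h a ha b hb => h b hb a ha) fun h a ha b hb => h b hb a ha

theorem block_subset (S : Finset ℕ) (k j : ℕ) : block S k j ⊆ S := filter_subset _ _

theorem block_eq_filter {S : Finset ℕ} {k l j i : ℕ} (hi : i ∈ children l j) :
    block S k i = (block S (k + l) j).filter fun a => a / 256 ^ k = i := by
  rw [children, mem_Ico] at hi
  ext a
  simp only [block, mem_filter, pow_add, ← Nat.div_div_eq_div_mul]
  refine ⟨fun h => ⟨⟨h.1, ?_⟩, h.2⟩, fun h => ⟨h.1.1, h.2⟩⟩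
  have h2 : 0 < 256 ^ l := by positivity
  rw [h.2, Nat.div_eq_iff h2]
  rw [add_mul, one_mul] at hi
  omega

theorem block_child_subset {S : Finset ℕ} {k l j i : ℕ} (hi : i ∈ children l j) :
    block S k i ⊆ block S (k + l) j := by
  rw [block_eq_filter hi]
  exact filter_subset _ _

theorem expSum_block (v : ℕ → V) (S : Finset ℕ) (k l j : ℕ) (χ : AddChar V ℂ) :
    expSum v (block S (k + l) j) χ = ∑ i ∈ children l j, expSum v (block S k i) χ := by
  rw [expSum, ← sum_fiberwise_of_maps_to (s := block S (k + l) j) (t := children l j)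
    (g := fun a => a / 256 ^ k)]
  · exact sum_congr rfl fun i hi => by rw [expSum, block_eq_filter hi]
  · intro a ha
    rw [block, mem_filter, pow_add, ← Nat.div_div_eq_div_mul] at ha
    have h2 : 0 < 256 ^ l := by positivity
    have h := (Nat.div_eq_iff h2).1 ha.2
    rw [children, mem_Ico, add_mul, one_mul]
    omega

variable [Fintype V]

/-- The (unnormalised) sixth moment of an exponential sum. -/
noncomputable def sixthMoment (v : ℕ → V) (s : Finset ℕ) : ℝ :=
  ∑ χ : AddChar V ℂ, ‖expSum v s χ‖ ^ 6

/-- The (unnormalised) mixed `2 + 4` moment of two exponential sums. -/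
noncomputable def mixedMoment (v : ℕ → V) (s t : Finset ℕ) : ℝ :=
  ∑ χ : AddChar V ℂ, ‖expSum v s χ‖ ^ 2 * ‖expSum v t χ‖ ^ 4

/-- The number of pairs with `g p - h q = x`, through orthogonality of characters. -/
theorem sum_char_eq_card {ι κ : Type*} [DecidableEq V] (P : Finset ι) (Q : Finset κ)
    (g : ι → V) (h : κ → V) (x : V) :
    ∑ χ : AddChar V ℂ, (∑ p ∈ P, χ (g p)) * conj (∑ q ∈ Q, χ (h q)) * conj (χ x) =
      (Fintype.card V : ℂ) * #{z ∈ P ×ˢ Q | g z.1 - h z.2 = x} := by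
  have key : ∀ χ : AddChar V ℂ,
      (∑ p ∈ P, χ (g p)) * conj (∑ q ∈ Q, χ (h q)) * conj (χ x) =
        ∑ z ∈ P ×ˢ Q, χ (g z.1 - h z.2 - x) := by
    intro χ
    rw [map_sum, sum_mul_sum, ← sum_product', sum_mul]
    refine sum_congr rfl fun z _ => ?_
    rw [sub_eq_add_neg, sub_eq_add_neg, χ.map_add_eq_mul, χ.map_add_eq_mul,
      AddChar.map_neg_eq_conj, AddChar.map_neg_eq_conj]
  simp_rw [key]
  rw [sum_comm]
  simp_rw [AddChar.sum_apply_eq_ite, sub_eq_zero]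
  rw [← sum_filter, sum_const, nsmul_eq_mul, mul_comm]

theorem card_triples_le_sixthMoment [DecidableEq V] (v : ℕ → V) (s : Finset ℕ) (x : V) :
    (Fintype.card V : ℝ) * #{z ∈ (s ×ˢ s ×ˢ s) ×ˢ (s ×ˢ s ×ˢ s) |
      (v z.1.1 + v z.1.2.1 + v z.1.2.2) - (v z.2.1 + v z.2.2.1 + v z.2.2.2) = x} ≤
      sixthMoment v s := by
  have h := sum_char_eq_card (s ×ˢ s ×ˢ s) (s ×ˢ s ×ˢ s)
    (fun p => v p.1 + v p.2.1 + v p.2.2) (fun p => v p.1 + v p.2.1 + v p.2.2) x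
  simp_rw [← expSum_mul_mul] at h
  have h2 := congrArg norm h
  rw [norm_mul, Complex.norm_natCast, Complex.norm_natCast] at h2
  rw [← h2]
  refine (norm_sum_le _ _).trans (sum_le_sum fun χ _ => le_of_eq ?_)
  simp only [norm_mul, RCLike.norm_conj, AddChar.norm_apply]
  ring

theorem sum_expSum_eq_zero (v : ℕ → V) (s s' t : Finset ℕ)
    (h : ∀ a ∈ s, ∀ a' ∈ s', ∀ b₁ ∈ t, ∀ b₂ ∈ t, ∀ b₃ ∈ t, ∀ b₄ ∈ t,
      v a + v b₁ + v b₂ ≠ v a' + v b₃ + v b₄) :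
    ∑ χ : AddChar V ℂ,
      expSum v s χ * conj (expSum v s' χ) * ((‖expSum v t χ‖ ^ 4 : ℝ) : ℂ) = 0 := by
  classical
  have h0 := sum_char_eq_card (s ×ˢ t ×ˢ t) (s' ×ˢ t ×ˢ t)
    (fun p => v p.1 + v p.2.1 + v p.2.2) (fun p => v p.1 + v p.2.1 + v p.2.2) 0
  simp_rw [← expSum_mul_mul] at h0
  rw [filter_false_of_mem, card_empty, Nat.cast_zero, mul_zero] at h0
  · rw [← h0]
    refine sum_congr rfl fun χ _ => ?_
    have : ((‖expSum v t χ‖ ^ 4 : ℝ) : ℂ) = (expSum v t χ * conj (expSum v t χ)) ^ 2 := by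
      rw [Complex.mul_conj, Complex.normSq_eq_norm_sq]
      push_cast
      ring
    rw [this, AddChar.map_zero_eq_one]
    simp only [map_mul, map_one]
    ring
  · rintro ⟨⟨a, b, c⟩, ⟨a', b', c'⟩⟩ hz
    simp only [mem_product] at hz
    rw [sub_eq_zero]
    exact h _ hz.1.1 _ hz.2.1 _ hz.1.2.1 _ hz.1.2.2 _ hz.2.2.1 _ hz.2.2.2

/-- Almost orthogonality: if only pairs of indices at distance at most `D` interact, then the
square function estimate holds with constant `2 * D + 1`. -/
theorem sum_norm_sq_le_of_almost_orthogonal {X : Type*} [Fintype X] (T : Finset ℕ) (D : ℕ)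
    (z : ℕ → X → ℂ) (W : X → ℝ) (hW : ∀ x, 0 ≤ W x)
    (h : ∀ i ∈ T, ∀ j ∈ T, ¬ (i ≤ j + D ∧ j ≤ i + D) →
      ∑ x, z i x * conj (z j x) * (W x : ℂ) = 0) :
    ∑ x, ‖∑ i ∈ T, z i x‖ ^ 2 * W x ≤ (2 * D + 1) * ∑ i ∈ T, ∑ x, ‖z i x‖ ^ 2 * W x := by
  classical
  set c : ℕ → ℝ := fun i => ∑ x, ‖z i x‖ ^ 2 * W x with hc
  have hc0 : ∀ i, 0 ≤ c i := fun i => sum_nonneg fun x _ => mul_nonneg (sq_nonneg _) (hW x)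
  have h1 : ((∑ x, ‖∑ i ∈ T, z i x‖ ^ 2 * W x : ℝ) : ℂ) =
      ∑ i ∈ T, ∑ j ∈ T, ∑ x, z i x * conj (z j x) * (W x : ℂ) := by
    push_cast
    simp_rw [sum_comm (s := T) (t := univ)]
    refine sum_congr rfl fun x _ => ?_
    rw [← Complex.ofReal_pow, ← Complex.normSq_eq_norm_sq, ← Complex.mul_conj, map_sum,
      sum_mul_sum, sum_mul]
    exact sum_congr rfl fun i _ => by rw [sum_mul]
  have h2 : ∑ x, ‖∑ i ∈ T, z i x‖ ^ 2 * W x =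
      ‖∑ i ∈ T, ∑ j ∈ T, ∑ x, z i x * conj (z j x) * (W x : ℂ)‖ := by
    rw [← h1, Complex.norm_real, Real.norm_of_nonneg]
    exact sum_nonneg fun x _ => mul_nonneg (sq_nonneg _) (hW x)
  have h3 : ∀ i ∈ T, ∀ j ∈ T, ‖∑ x, z i x * conj (z j x) * (W x : ℂ)‖ ≤
      if i ≤ j + D ∧ j ≤ i + D then (c i + c j) / 2 else 0 := by
    intro i hi j hj
    split_ifs with hij
    · refine (norm_sum_le _ _).trans ?_
      rw [hc]
      simp only
      rw [← sum_add_distrib, sum_div]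
      refine sum_le_sum fun x _ => ?_
      rw [norm_mul, norm_mul, RCLike.norm_conj, Complex.norm_real, Real.norm_of_nonneg (hW x)]
      nlinarith [mul_nonneg (sq_nonneg (‖z i x‖ - ‖z j x‖)) (hW x)]
    · rw [h i hi j hj hij, norm_zero]
  have h4 : ∀ i, ((#{j ∈ T | i ≤ j + D ∧ j ≤ i + D} : ℕ) : ℝ) ≤ 2 * D + 1 := by
    intro i
    have : #{j ∈ T | i ≤ j + D ∧ j ≤ i + D} ≤ #(Icc (i - D) (i + D)) := by
      refine card_le_card fun j hj => ?_
      rw [mem_filter] at hj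
      rw [mem_Icc]
      omega
    rw [Nat.card_Icc] at this
    have h5 : #{j ∈ T | i ≤ j + D ∧ j ≤ i + D} ≤ 2 * D + 1 := by omega
    exact_mod_cast h5
  have h5 : ∑ i ∈ T, ∑ j ∈ T, (if i ≤ j + D ∧ j ≤ i + D then c i else 0) ≤
      (2 * D + 1) * ∑ i ∈ T, c i := by
    rw [mul_sum]
    refine sum_le_sum fun i _ => ?_
    rw [← sum_filter, sum_const, nsmul_eq_mul]
    exact mul_le_mul_of_nonneg_right (h4 i) (hc0 i)
  have h6 : ∑ i ∈ T, ∑ j ∈ T, (if i ≤ j + D ∧ j ≤ i + D then c j else 0) ≤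
      (2 * D + 1) * ∑ i ∈ T, c i := by
    rw [sum_comm]
    refine le_trans (le_of_eq ?_) h5
    exact sum_congr rfl fun i _ => sum_congr rfl fun j _ => by simp only [and_comm]
  rw [h2]
  calc _ ≤ ∑ i ∈ T, ∑ j ∈ T, ‖∑ x, z i x * conj (z j x) * (W x : ℂ)‖ :=
        (norm_sum_le _ _).trans (sum_le_sum fun i _ => norm_sum_le _ _)
    _ ≤ ∑ i ∈ T, ∑ j ∈ T, if i ≤ j + D ∧ j ≤ i + D then (c i + c j) / 2 else 0 :=
        sum_le_sum fun i hi => sum_le_sum fun j hj => h3 i hi j hj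
    _ = (∑ i ∈ T, ∑ j ∈ T, (if i ≤ j + D ∧ j ≤ i + D then c i else 0) +
        ∑ i ∈ T, ∑ j ∈ T, (if i ≤ j + D ∧ j ≤ i + D then c j else 0)) / 2 := by
        rw [← sum_add_distrib, sum_div]
        refine sum_congr rfl fun i _ => ?_
        rw [← sum_add_distrib, sum_div]
        refine sum_congr rfl fun j _ => ?_
        split_ifs <;> ring
    _ ≤ _ := by linarith

theorem sixthMoment_nonneg (v : ℕ → V) (s : Finset ℕ) : 0 ≤ sixthMoment v s :=
  sum_nonneg fun _ _ => by positivity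

theorem mixedMoment_nonneg (v : ℕ → V) (s t : Finset ℕ) : 0 ≤ mixedMoment v s t :=
  sum_nonneg fun _ _ => by positivity

theorem mixedMoment_le_add (v : ℕ → V) (s t : Finset ℕ) :
    mixedMoment v s t ≤ sixthMoment v s + sixthMoment v t := by
  rw [mixedMoment, sixthMoment, sixthMoment, ← sum_add_distrib]
  refine sum_le_sum fun χ _ => ?_
  set x := ‖expSum v s χ‖
  set y := ‖expSum v t χ‖
  have hx : 0 ≤ x := norm_nonneg _
  have hy : 0 ≤ y := norm_nonneg _
  rcases le_total x y with h | h
  · have : x ^ 2 * y ^ 4 ≤ y ^ 2 * y ^ 4 := by gcongr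
    have : 0 ≤ x ^ 6 := by positivity
    nlinarith
  · have : x ^ 2 * y ^ 4 ≤ x ^ 2 * x ^ 4 := by gcongr
    have : 0 ≤ y ^ 6 := by positivity
    nlinarith

theorem mixedMoment_sq_le (v : ℕ → V) (s t : Finset ℕ) :
    mixedMoment v s t ^ 2 ≤ mixedMoment v t s * sixthMoment v t := by
  have := sum_mul_sq_le_sq_mul_sq (univ : Finset (AddChar V ℂ))
    (fun χ => ‖expSum v s χ‖ ^ 2 * ‖expSum v t χ‖) (fun χ => ‖expSum v t χ‖ ^ 3)
  calc _ = (∑ χ : AddChar V ℂ,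
        ‖expSum v s χ‖ ^ 2 * ‖expSum v t χ‖ * ‖expSum v t χ‖ ^ 3) ^ 2 := by
        rw [mixedMoment]; congr 1; exact sum_congr rfl fun _ _ => by ring
    _ ≤ _ := this
    _ = _ := by
        rw [mixedMoment, sixthMoment]
        congr 1 <;> exact sum_congr rfl fun _ _ => by ring

theorem sixthMoment_le_card (v : ℕ → V) (s : Finset ℕ) :
    sixthMoment v s ≤ Fintype.card V * (#s : ℝ) ^ 6 := by
  have h : ∀ χ : AddChar V ℂ, ‖expSum v s χ‖ ≤ #s := fun χ => by
    refine (norm_sum_le _ _).trans ?_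
    simp [AddChar.norm_apply]
  calc _ ≤ ∑ χ : AddChar V ℂ, (#s : ℝ) ^ 6 :=
        sum_le_sum fun χ _ => pow_le_pow_left₀ (norm_nonneg _) (h χ) 6
    _ = _ := by
        rw [sum_const, nsmul_eq_mul, card_univ, AddChar.card_eq]

/-- If `i₀` is dominant, either its neighbours control the sum or a distant term does. -/
theorem norm_sum_pow_six_le (T : Finset ℕ) (hT : #T = 256) (z : ℕ → ℂ) :
    ‖∑ i ∈ T, z i‖ ^ 6 ≤ 23328 * ∑ i ∈ T, ‖z i‖ ^ 6 +
      32 * 256 ^ 6 * ∑ i ∈ T, ∑ j ∈ T with ¬ (j ≤ i + 1 ∧ i ≤ j + 1),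
        ‖z i‖ ^ 2 * ‖z j‖ ^ 4 := by
  obtain ⟨i, hi, hmax⟩ := exists_max_image T (fun i => ‖z i‖) (card_pos.1 (by omega))
  have hnear : ‖∑ j ∈ T with (j ≤ i + 1 ∧ i ≤ j + 1), z j‖ ≤ 3 * ‖z i‖ := by
    refine (norm_sum_le_of_le _ fun j hj => hmax j (mem_filter.1 hj).1).trans ?_
    rw [sum_const, nsmul_eq_mul]
    refine mul_le_mul_of_nonneg_right ?_ (norm_nonneg _)
    have : #{j ∈ T | j ≤ i + 1 ∧ i ≤ j + 1} ≤ #(Icc (i - 1) (i + 1)) := by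
      refine card_le_card fun j hj => ?_
      rw [mem_filter] at hj
      rw [mem_Icc]
      omega
    rw [Nat.card_Icc] at this
    have h3 : #{j ∈ T | j ≤ i + 1 ∧ i ≤ j + 1} ≤ 3 := by omega
    exact_mod_cast h3
  have hfar : ‖∑ j ∈ T with ¬ (j ≤ i + 1 ∧ i ≤ j + 1), z j‖ ^ 6 ≤
      256 ^ 6 * ∑ j ∈ T with ¬ (j ≤ i + 1 ∧ i ≤ j + 1), ‖z i‖ ^ 2 * ‖z j‖ ^ 4 := by
    rcases (filter (fun j => ¬ (j ≤ i + 1 ∧ i ≤ j + 1)) T).eq_empty_or_nonempty with h0 | h0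
    · rw [h0]; simp
    · obtain ⟨l, hl, hlmax⟩ := exists_max_image _ (fun i => ‖z i‖) h0
      have h1 : ‖∑ j ∈ T with ¬ (j ≤ i + 1 ∧ i ≤ j + 1), z j‖ ≤ 256 * ‖z l‖ := by
        refine (norm_sum_le_of_le _ fun j hj => hlmax j hj).trans ?_
        rw [sum_const, nsmul_eq_mul]
        refine mul_le_mul_of_nonneg_right ?_ (norm_nonneg _)
        have := hT ▸ card_filter_le T (fun j => ¬ (j ≤ i + 1 ∧ i ≤ j + 1))
        exact_mod_cast this
      calc _ ≤ (256 * ‖z l‖) ^ 6 := pow_le_pow_left₀ (norm_nonneg _) h1 6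
        _ = 256 ^ 6 * (‖z l‖ ^ 2 * ‖z l‖ ^ 4) := by ring
        _ ≤ 256 ^ 6 * (‖z i‖ ^ 2 * ‖z l‖ ^ 4) := by
            have := hmax l (mem_filter.1 hl).1
            gcongr
        _ ≤ _ := by
            refine mul_le_mul_of_nonneg_left ?_ (by positivity)
            exact single_le_sum (f := fun j => ‖z i‖ ^ 2 * ‖z j‖ ^ 4)
              (fun _ _ => by positivity) hl
  have h1 : ‖z i‖ ^ 6 ≤ ∑ i ∈ T, ‖z i‖ ^ 6 :=
    single_le_sum (f := fun i => ‖z i‖ ^ 6) (fun _ _ => by positivity) hi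
  have h2 : ∑ j ∈ T with ¬ (j ≤ i + 1 ∧ i ≤ j + 1), ‖z i‖ ^ 2 * ‖z j‖ ^ 4 ≤
      ∑ i ∈ T, ∑ j ∈ T with ¬ (j ≤ i + 1 ∧ i ≤ j + 1), ‖z i‖ ^ 2 * ‖z j‖ ^ 4 :=
    single_le_sum
      (f := fun i => ∑ j ∈ T with ¬ (j ≤ i + 1 ∧ i ≤ j + 1), ‖z i‖ ^ 2 * ‖z j‖ ^ 4)
      (fun _ _ => sum_nonneg fun _ _ => by positivity) hi
  rw [← sum_filter_add_sum_filter_not T (fun j => j ≤ i + 1 ∧ i ≤ j + 1)]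
  calc _ ≤ (‖∑ j ∈ T with (j ≤ i + 1 ∧ i ≤ j + 1), z j‖ +
        ‖∑ j ∈ T with ¬ (j ≤ i + 1 ∧ i ≤ j + 1), z j‖) ^ 6 :=
        pow_le_pow_left₀ (norm_nonneg _) (norm_add_le _ _) 6
    _ ≤ 2 ^ (6 - 1) * (‖∑ j ∈ T with (j ≤ i + 1 ∧ i ≤ j + 1), z j‖ ^ 6 +
        ‖∑ j ∈ T with ¬ (j ≤ i + 1 ∧ i ≤ j + 1), z j‖ ^ 6) :=
        add_pow_le (norm_nonneg _) (norm_nonneg _) 6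
    _ ≤ 2 ^ (6 - 1) * ((3 * ‖z i‖) ^ 6 +
        256 ^ 6 * ∑ j ∈ T with ¬ (j ≤ i + 1 ∧ i ≤ j + 1), ‖z i‖ ^ 2 * ‖z j‖ ^ 4) := by
        gcongr
    _ = 23328 * ‖z i‖ ^ 6 + 32 * 256 ^ 6 *
          ∑ j ∈ T with ¬ (j ≤ i + 1 ∧ i ≤ j + 1), ‖z i‖ ^ 2 * ‖z j‖ ^ 4 := by ring
    _ ≤ _ := by gcongr

theorem card_block_le (S : Finset ℕ) (k j : ℕ) : #(block S k j) ≤ 256 ^ k := by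
  rw [← card_children k j]
  refine card_le_card fun a ha => ?_
  rw [mem_block] at ha
  exact mem_Ico.2 ha.2

theorem separated_block (S : Finset ℕ) (k i j : ℕ) (h : ¬ (j ≤ i + 1 ∧ i ≤ j + 1)) :
    Separated (256 ^ k) (block S k i) (block S k j) := by
  rcases lt_or_ge (i + 1) j with hij | hij
  · refine Or.inr fun a ha b hb => ?_
    have := Nat.mul_le_mul_right (256 ^ k) (show i + 1 + 1 ≤ j from hij)
    rw [mem_block] at ha hb
    rw [add_mul _ 1] at this
    linarith [ha.2.2, hb.2.1]
  · refine Or.inl fun a ha b hb => ?_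
    have := Nat.mul_le_mul_right (256 ^ k) (show j + 1 + 1 ≤ i by omega)
    rw [mem_block] at ha hb
    rw [add_mul _ 1] at this
    linarith [ha.2.1, hb.2.2]

theorem sixthMoment_block_succ_le (v : ℕ → V) (S : Finset ℕ) (k j : ℕ) :
    sixthMoment v (block S (k + 1) j) ≤
      23328 * ∑ i ∈ children 1 j, sixthMoment v (block S k i) +
      32 * 256 ^ 6 * ∑ i ∈ children 1 j, ∑ i' ∈ children 1 j with
        ¬ (i' ≤ i + 1 ∧ i ≤ i' + 1), mixedMoment v (block S k i) (block S k i') := by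
  simp only [sixthMoment, mixedMoment, expSum_block v S k 1 j]
  rw [sum_comm, mul_sum, sum_congr rfl fun i _ => sum_comm, sum_comm, mul_sum,
    ← sum_add_distrib]
  refine sum_le_sum fun χ _ => norm_sum_pow_six_le _ ?_ _
  rw [card_children, pow_one]

theorem mixedMoment_block_succ_le (v : ℕ → V) (S I : Finset ℕ) (k j : ℕ) :
    mixedMoment v I (block S (k + 1) j) ≤
      256 ^ 3 * ∑ i ∈ children 1 j, mixedMoment v I (block S k i) := by
  simp only [mixedMoment, expSum_block v S k 1 j]
  rw [sum_comm, mul_sum]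
  refine sum_le_sum fun χ _ => ?_
  rw [← mul_sum, mul_left_comm]
  refine mul_le_mul_of_nonneg_left ?_ (sq_nonneg _)
  calc _ ≤ (∑ i ∈ children 1 j, ‖expSum v (block S k i) χ‖) ^ (3 + 1) :=
        pow_le_pow_left₀ (norm_nonneg _) (norm_sum_le _ _) 4
    _ ≤ (#(children 1 j) : ℝ) ^ 3 * ∑ i ∈ children 1 j, ‖expSum v (block S k i) χ‖ ^ (3 + 1) :=
        pow_sum_le_card_mul_sum_pow (fun _ _ => norm_nonneg _) 3
    _ = _ := by rw [card_children]; norm_num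

/-- The arithmetic input: on a set `J` of diameter `Y`, at distance `s` from `a` and `a'`, the
relation `v a + v b₁ + v b₂ = v a' + v b₃ + v b₄` forces `a` and `a'` to be close. This is what
curvature of `v` provides. -/
def IsCurved (v : ℕ → V) (S : Finset ℕ) : Prop :=
  ∀ s Y : ℕ, 1 ≤ Y → ∀ I ⊆ S, ∀ J ⊆ S, Separated s I J → (∀ b ∈ J, ∀ b' ∈ J, b ≤ b' + Y) →
    ∀ a ∈ I, ∀ a' ∈ I, ∀ b₁ ∈ J, ∀ b₂ ∈ J, ∀ b₃ ∈ J, ∀ b₄ ∈ J,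
      v a + v b₁ + v b₂ = v a' + v b₃ + v b₄ → a * s ≤ a' * s + 36 * Y ^ 2

theorem IsCurved.mixedMoment_block_le {v : ℕ → V} {S : Finset ℕ} (hv : IsCurved v S)
    {s k l k₂ : ℕ} (hk : 2 * k₂ = s + k + 1) {j j₂ : ℕ}
    (hsep : Separated (256 ^ s) (block S (k + l) j) (block S k₂ j₂)) :
    mixedMoment v (block S (k + l) j) (block S k₂ j₂) ≤
      18433 * ∑ i ∈ children l j, mixedMoment v (block S k i) (block S k₂ j₂) := by
  have hclose : ∀ i ∈ children l j, ∀ i' ∈ children l j, ∀ a ∈ block S k i,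
      ∀ a' ∈ block S k i', ∀ b₁ ∈ block S k₂ j₂, ∀ b₂ ∈ block S k₂ j₂, ∀ b₃ ∈ block S k₂ j₂,
      ∀ b₄ ∈ block S k₂ j₂, v a + v b₁ + v b₂ = v a' + v b₃ + v b₄ → i ≤ i' + 9216 := by
    intro i hi i' hi' a ha a' ha' b₁ h₁ b₂ h₂ b₃ h₃ b₄ h₄ h
    have h5 := hv (256 ^ s) (256 ^ k₂) (Nat.one_le_pow _ _ (by norm_num)) _ (block_subset _ _ _) _
      (block_subset _ _ _) hsep ?_ a (block_child_subset hi ha) a' (block_child_subset hi' ha')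
      b₁ h₁ b₂ h₂ b₃ h₃ b₄ h₄ h
    · have h6 : 36 * (256 ^ k₂) ^ 2 = 9216 * 256 ^ k * 256 ^ s := by
        rw [← pow_mul, mul_comm k₂, hk]
        ring
      rw [h6, ← add_mul] at h5
      have h7 := Nat.le_of_mul_le_mul_right h5 (by positivity)
      rw [mem_block] at ha ha'
      have h8 : i * 256 ^ k < (i' + 9216 + 1) * 256 ^ k := by
        have := ha.2.1
        have := ha'.2.2
        rw [add_mul, one_mul] at this
        rw [add_mul, add_mul, one_mul]
        omega
      have := Nat.lt_of_mul_lt_mul_right h8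
      omega
    · intro b hb b' hb'
      rw [mem_block, add_mul, one_mul] at hb hb'
      omega
  have key := sum_norm_sq_le_of_almost_orthogonal (children l j) 9216
    (fun i χ => expSum v (block S k i) χ) (fun χ => ‖expSum v (block S k₂ j₂) χ‖ ^ 4)
    (fun _ => by positivity) fun i hi i' hi' hii' => sum_expSum_eq_zero v _ _ _ ?_
  · simp only [← expSum_block] at key
    norm_num at key
    exact key
  · intro a ha a' ha' b₁ h₁ b₂ h₂ b₃ h₃ b₄ h₄ h
    exact hii' ⟨hclose i hi i' hi' a ha a' ha' b₁ h₁ b₂ h₂ b₃ h₃ b₄ h₄ h,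
      hclose i' hi' i hi a' ha' a ha b₃ h₃ b₄ h₄ b₁ h₁ b₂ h₂ h.symm⟩

theorem IsCurved.mixedMoment_iterate {v : ℕ → V} {S : Finset ℕ} (hv : IsCurved v S)
    {P θ : ℝ} (hP : 0 ≤ P) (hθ : 1 ≤ θ) {m : ℕ}
    (hD : ∀ k < m, ∀ j, sixthMoment v (block S k j) ≤ P * (256 ^ 3 * θ) ^ k) (n : ℕ) :
    ∀ i, 1 ≤ i → 2 ^ (n + 1) * i ≤ m → ∀ j j',
      Separated (256 ^ (m - 1)) (block S (m - i) j) (block S (m - 2 * i) j') →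
      mixedMoment v (block S (m - i) j) (block S (m - 2 * i) j') * θ ^ (i * n) ≤
        18433 ^ 2 * P * (256 ^ 3 * θ) ^ m := by
  have hw : 1 ≤ 256 ^ 3 * θ := by linarith
  induction n with
  | zero =>
    intro i hi him j j' _
    rw [mul_zero, pow_zero, mul_one]
    refine (mixedMoment_le_add _ _ _).trans ?_
    have h : ∀ k < m, ∀ j, sixthMoment v (block S k j) ≤ P * (256 ^ 3 * θ) ^ m :=
      fun k hk j => (hD k hk j).trans
        (mul_le_mul_of_nonneg_left (pow_le_pow_right₀ hw hk.le) hP)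
    have h1 := h (m - i) (by omega) j
    have h2 := h (m - 2 * i) (by omega) j'
    have : 0 ≤ P * (256 ^ 3 * θ) ^ m := by positivity
    linarith
  | succ n ih =>
    intro i hi him j j' hsep
    have h4 : 4 * i ≤ m := by
      have : 4 * i ≤ 2 ^ (n + 1 + 1) * i := by
        have := Nat.one_le_two_pow (n := n)
        rw [pow_succ, pow_succ]
        nlinarith
      omega
    have e1 : m - i = (m - 4 * i) + 3 * i := by omega
    have e2 : m - 2 * (2 * i) = m - 4 * i := by omega
    rw [e1] at hsep ⊢
    have hmain := hv.mixedMoment_block_le (s := m - 1) (by omega) hsep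
    have hchild : ∀ i' ∈ children (3 * i) j,
        mixedMoment v (block S (m - 4 * i) i') (block S (m - 2 * i) j') *
          (θ ^ (i * (n + 1)) * 256 ^ (3 * i)) ≤ 18433 * P * (256 ^ 3 * θ) ^ m := by
      intro i' hi'
      have h1 := ih (2 * i) (by omega) (by rw [← mul_assoc, ← pow_succ]; exact him) j' i'
        (e2 ▸ (hsep.mono (block_child_subset hi') (Subset.refl _)).symm)
      rw [e2] at h1
      have h2 := hD (m - 2 * i) (by omega) j'
      have h3 := mixedMoment_sq_le v (block S (m - 4 * i) i') (block S (m - 2 * i) j')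
      have hm0 := mixedMoment_nonneg v (block S (m - 2 * i) j') (block S (m - 4 * i) i')
      refine (sq_le_sq₀ (mul_nonneg (mixedMoment_nonneg _ _ _) (by positivity)) (by positivity)).1 ?_
      have e3 : (256 ^ 3 * θ) ^ m = (256 ^ 3 * θ) ^ (m - 2 * i) * (256 ^ 3 * θ) ^ (2 * i) := by
        rw [← pow_add]; congr 1; omega
      have e4 : (256 ^ 3 * θ) ^ (2 * i) = (256 ^ (3 * i)) ^ 2 * θ ^ (2 * i) := by
        rw [mul_pow, ← pow_mul, ← pow_mul]
        congr 2
        ring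
      calc _ = mixedMoment v (block S (m - 4 * i) i') (block S (m - 2 * i) j') ^ 2 *
            (θ ^ (i * (n + 1)) * 256 ^ (3 * i)) ^ 2 := mul_pow _ _ _
        _ ≤ (mixedMoment v (block S (m - 2 * i) j') (block S (m - 4 * i) i') *
            (P * (256 ^ 3 * θ) ^ (m - 2 * i))) * (θ ^ (i * (n + 1)) * 256 ^ (3 * i)) ^ 2 := by
            gcongr
            exact h3.trans (mul_le_mul_of_nonneg_left h2 hm0)
        _ = (mixedMoment v (block S (m - 2 * i) j') (block S (m - 4 * i) i') *
            θ ^ (2 * i * n)) * (P * ((256 ^ 3 * θ) ^ (m - 2 * i) * (256 ^ 3 * θ) ^ (2 * i))) := by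
            rw [e4]
            ring
        _ ≤ (18433 ^ 2 * P * (256 ^ 3 * θ) ^ m) * (P * (256 ^ 3 * θ) ^ m) := by
            rw [← e3]
            gcongr
        _ = _ := by ring
    have hpos : (0 : ℝ) < 256 ^ (3 * i) := by positivity
    refine le_of_mul_le_mul_right ?_ hpos
    calc _ = mixedMoment v (block S (m - 4 * i + 3 * i) j) (block S (m - 2 * i) j') *
          (θ ^ (i * (n + 1)) * 256 ^ (3 * i)) := by ring
      _ ≤ (18433 * ∑ i' ∈ children (3 * i) j,
          mixedMoment v (block S (m - 4 * i) i') (block S (m - 2 * i) j')) *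
          (θ ^ (i * (n + 1)) * 256 ^ (3 * i)) := by gcongr
      _ = 18433 * ∑ i' ∈ children (3 * i) j,
          mixedMoment v (block S (m - 4 * i) i') (block S (m - 2 * i) j') *
          (θ ^ (i * (n + 1)) * 256 ^ (3 * i)) := by rw [mul_assoc, sum_mul]
      _ ≤ 18433 * ∑ i' ∈ children (3 * i) j, 18433 * P * (256 ^ 3 * θ) ^ m := by
          exact mul_le_mul_of_nonneg_left (sum_le_sum hchild) (by norm_num)
      _ = _ := by
          rw [sum_const, card_children, nsmul_eq_mul]
          push_cast
          ring

theorem IsCurved.sixthMoment_block_le {v : ℕ → V} {S : Finset ℕ} (hv : IsCurved v S)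
    {θ : ℝ} (hθ : 1 ≤ θ) {n : ℕ} (hn : 64 * 256 ^ 12 * 18433 ^ 2 ≤ θ ^ n) (m j : ℕ) :
    sixthMoment v (block S m j) ≤
      (256 ^ (6 * 2 ^ (n + 1)) * Fintype.card V) * (256 ^ 3 * θ) ^ m := by
  set P : ℝ := 256 ^ (6 * 2 ^ (n + 1)) * Fintype.card V with hPdef
  have hP : 0 ≤ P := by positivity
  have hw : 1 ≤ 256 ^ 3 * θ := by linarith
  induction m using Nat.strong_induction_on generalizing j with
  | _ m hD =>
  rcases lt_or_ge m (2 ^ (n + 1)) with hm | hm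
  · have h1 : ((#(block S m j) : ℕ) : ℝ) ^ 6 ≤ 256 ^ (6 * 2 ^ (n + 1)) := by
      have : ((#(block S m j) : ℕ) : ℝ) ≤ 256 ^ m := mod_cast card_block_le S m j
      calc _ ≤ ((256 : ℝ) ^ m) ^ 6 := by gcongr
        _ = 256 ^ (6 * m) := by rw [← pow_mul, mul_comm]
        _ ≤ _ := pow_le_pow_right₀ (by norm_num) (by omega)
    calc _ ≤ Fintype.card V * ((#(block S m j) : ℕ) : ℝ) ^ 6 := sixthMoment_le_card _ _
      _ ≤ Fintype.card V * 256 ^ (6 * 2 ^ (n + 1)) := by gcongr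
      _ = P * 1 := by rw [hPdef]; ring
      _ ≤ _ := by gcongr; exact one_le_pow₀ hw
  · have h2 : 2 ≤ m := by
      have := Nat.one_le_two_pow (n := n)
      rw [pow_succ] at hm
      omega
    have hmixed : ∀ a b, ¬ (b ≤ a + 1 ∧ a ≤ b + 1) →
        mixedMoment v (block S (m - 1) a) (block S (m - 1) b) * (64 * 256 ^ 8) ≤
          P * (256 ^ 3 * θ) ^ m := by
      intro a b hab
      have hsep := separated_block S (m - 1) a b hab
      have e : m - 1 = m - 2 * 1 + 1 := by omega
      have hsub : ∀ c ∈ children 1 b,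
          mixedMoment v (block S (m - 1) a) (block S (m - 2 * 1) c) * (64 * 256 ^ 12) ≤
            P * (256 ^ 3 * θ) ^ m := by
        intro c hc
        have hcb := block_child_subset (S := S) (k := m - 2 * 1) hc
        rw [← e] at hcb
        have h := hv.mixedMoment_iterate hP hθ hD n 1 le_rfl (by omega) a c
          (hsep.mono (Subset.refl _) hcb)
        rw [one_mul] at h
        have h0 := mixedMoment_nonneg v (block S (m - 1) a) (block S (m - 2 * 1) c)
        have h3 := mul_le_mul_of_nonneg_left hn h0
        linarith
      have h := mixedMoment_block_succ_le v S (block S (m - 1) a) (m - 2 * 1) b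
      rw [← e] at h
      calc _ ≤ (256 ^ 3 * ∑ c ∈ children 1 b,
            mixedMoment v (block S (m - 1) a) (block S (m - 2 * 1) c)) * (64 * 256 ^ 8) := by
            gcongr
        _ = (∑ c ∈ children 1 b, mixedMoment v (block S (m - 1) a) (block S (m - 2 * 1) c) *
            (64 * 256 ^ 12)) / 256 := by rw [← sum_mul]; ring
        _ ≤ (∑ c ∈ children 1 b, P * (256 ^ 3 * θ) ^ m) / 256 := by
            exact div_le_div_of_nonneg_right (sum_le_sum hsub) (by norm_num)
        _ = _ := by
            rw [sum_const, card_children, nsmul_eq_mul]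
            push_cast
            ring
    have h := sixthMoment_block_succ_le v S (m - 1) j
    have e : m - 1 + 1 = m := by omega
    rw [e] at h
    have hA : ∑ i ∈ children 1 j, sixthMoment v (block S (m - 1) i) ≤
        P * (256 ^ 3 * θ) ^ m / 65536 := by
      calc _ ≤ ∑ i ∈ children 1 j, P * (256 ^ 3 * θ) ^ (m - 1) :=
            sum_le_sum fun i _ => hD _ (by omega) i
        _ = 256 * P * (256 ^ 3 * θ) ^ (m - 1) := by
            rw [sum_const, card_children, nsmul_eq_mul]
            push_cast
            ring
        _ ≤ 256 * P * (256 ^ 3 * θ) ^ (m - 1) * θ :=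
            le_mul_of_one_le_right (by positivity) hθ
        _ = P * ((256 ^ 3 * θ) ^ (m - 1) * (256 ^ 3 * θ)) / 65536 := by ring
        _ = _ := by rw [← pow_succ, e]
    have hB : ∑ i ∈ children 1 j, ∑ i' ∈ children 1 j with ¬ (i' ≤ i + 1 ∧ i ≤ i' + 1),
        mixedMoment v (block S (m - 1) i) (block S (m - 1) i') ≤
        P * (256 ^ 3 * θ) ^ m / (64 * 256 ^ 6) := by
      calc _ ≤ ∑ i ∈ children 1 j, ∑ i' ∈ children 1 j,
            P * (256 ^ 3 * θ) ^ m / (64 * 256 ^ 8) := by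
            refine sum_le_sum fun i _ => ?_
            refine (sum_le_sum fun i' hi' => ?_).trans
              (sum_le_sum_of_subset_of_nonneg (filter_subset _ _) fun _ _ _ => by positivity)
            rw [le_div_iff₀ (by positivity)]
            exact hmixed i i' (mem_filter.1 hi').2
        _ = _ := by
            rw [sum_const, sum_const, card_children, nsmul_eq_mul, nsmul_eq_mul]
            push_cast
            ring
    have h0 : 0 ≤ P * (256 ^ 3 * θ) ^ m := by positivity
    refine h.trans ?_
    calc _ ≤ 23328 * (P * (256 ^ 3 * θ) ^ m / 65536) +
          32 * 256 ^ 6 * (P * (256 ^ 3 * θ) ^ m / (64 * 256 ^ 6)) :=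
          add_le_add (mul_le_mul_of_nonneg_left hA (by norm_num))
            (mul_le_mul_of_nonneg_left hB (by norm_num))
      _ = (23328 / 65536 + 1 / 2) * (P * (256 ^ 3 * θ) ^ m) := by ring
      _ ≤ 1 * (P * (256 ^ 3 * θ) ^ m) := mul_le_mul_of_nonneg_right (by norm_num) h0
      _ = _ := one_mul _

end Moments

section Logarithm

theorem log_sub_log_le {x y : ℝ} (hx : 0 < x) (hy : 0 < y) :
    Real.log x - Real.log y ≤ (x - y) / y := by
  rw [← Real.log_div hx.ne' hy.ne', sub_div, div_self hy.ne']
  exact Real.log_le_sub_one_of_pos (div_pos hx hy)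

theorem sq_mul_log_tangent {N x y : ℝ} (hN : 0 < N) (hx : N ≤ x) (hy : N ≤ y) :
    N ^ 2 * (Real.log x - Real.log y - (x - y) / y) ≤ 0 ∧
      -(x - y) ^ 2 ≤ N ^ 2 * (Real.log x - Real.log y - (x - y) / y) := by
  have hx0 : 0 < x := by linarith
  have hy0 : 0 < y := by linarith
  have h1 := log_sub_log_le hx0 hy0
  have h2 := log_sub_log_le hy0 hx0
  refine ⟨mul_nonpos_of_nonneg_of_nonpos (by positivity) (by linarith), ?_⟩
  have h3 : (y - x) / x + (x - y) / y = (x - y) ^ 2 / (x * y) := by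
    field_simp
    ring
  have h4 : N ^ 2 * ((x - y) ^ 2 / (x * y)) ≤ (x - y) ^ 2 := by
    rw [mul_div_assoc', div_le_iff₀ (by positivity), mul_comm]
    have : N ^ 2 ≤ x * y := by nlinarith
    gcongr
  have h5 : N ^ 2 * (-((x - y) ^ 2 / (x * y))) ≤
      N ^ 2 * (Real.log x - Real.log y - (x - y) / y) := by
    gcongr
    linarith
  linarith

theorem sq_mul_sub_div_mul_ge {N a a' b c s : ℝ} (hN : 0 < N) (hb : N ≤ b) (hc : N ≤ c)
    (hb2 : b ≤ 2 * N) (hc2 : c ≤ 2 * N) (ha : a' ≤ a) (hs0 : 0 ≤ s) (hs : b + s ≤ c) :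
    (a - a') * s / 4 ≤ N ^ 2 * ((a - a') / b - (a - a') / c) := by
  have hb0 : 0 < b := by linarith
  have hc0 : 0 < c := by linarith
  have h : N ^ 2 * ((a - a') / b - (a - a') / c) = (a - a') * (c - b) * (N ^ 2 / (b * c)) := by
    field_simp
  rw [h, div_eq_mul_one_div]
  have h1 : 1 / 4 ≤ N ^ 2 / (b * c) := by
    rw [div_le_div_iff₀ (by norm_num) (by positivity)]
    nlinarith
  have h2 : 0 ≤ a - a' := by linarith
  have h3 : s ≤ c - b := by linarith
  have h4 : 0 ≤ (a - a') * (c - b) := mul_nonneg h2 (by linarith)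
  gcongr

/-- The logarithm bends away from its tangent at `b`, uniformly on `[N, 2 * N]`. -/
theorem sq_mul_log_curvature {N a a' b s : ℝ} (hN : 0 < N) (hb : N ≤ b) (hb2 : b ≤ 2 * N)
    (ha' : N ≤ a') (haa' : a' ≤ a) (ha2 : a ≤ 2 * N) (hs0 : 0 ≤ s)
    (h : b + s ≤ a' ∨ a + s ≤ b) :
    (a - a') * s / 4 ≤ |N ^ 2 * (Real.log a - Real.log a' - (a - a') / b)| := by
  have ha0 : 0 < a := by linarith
  have ha'0 : 0 < a' := by linarith
  rcases h with h | h
  · have h1 := sq_mul_sub_div_mul_ge (c := a') hN hb ha' hb2 (by linarith) haa' hs0 h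
    have h2 := mul_le_mul_of_nonneg_left (log_sub_log_le ha0 ha'0) (sq_nonneg N)
    refine le_trans ?_ (neg_le_abs _)
    linarith
  · have h1 := sq_mul_sub_div_mul_ge (b := a) hN (by linarith) hb (by linarith) hb2 haa' hs0 h
    have h2 := mul_le_mul_of_nonneg_left (log_sub_log_le ha'0 ha0) (sq_nonneg N)
    have h3 : (a' - a) / a = -((a - a') / a) := by ring
    rw [h3] at h2
    refine le_trans ?_ (le_abs_self _)
    linarith

/-- The integer points `(a, ⌊N² log (N + a)⌋)`, reduced modulo `Q`. -/
noncomputable def logPoint (N Q a : ℕ) : ZMod Q × ZMod Q :=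
  (((a : ℤ) : ZMod Q), ((⌊(N : ℝ) ^ 2 * Real.log (N + a)⌋ : ℤ) : ZMod Q))

theorem int_eq_of_zmod_eq {Q : ℕ} {x y : ℤ} (h : (x : ZMod Q) = y) (hxy : |x - y| < Q) :
    x = y := by
  rw [ZMod.intCast_eq_intCast_iff_dvd_sub] at h
  have := Int.eq_zero_of_abs_lt_dvd h (by rwa [abs_sub_comm])
  omega

theorem exists_modulus (N : ℕ) (S : Finset ℕ) : ∃ Q : ℕ, 0 < Q ∧
    ∀ a₁ ∈ S, ∀ a₂ ∈ S, ∀ a₃ ∈ S, ∀ a₄ ∈ S, ∀ a₅ ∈ S, ∀ a₆ ∈ S,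
      logPoint N Q a₁ + logPoint N Q a₂ + logPoint N Q a₃ =
        logPoint N Q a₄ + logPoint N Q a₅ + logPoint N Q a₆ →
      (a₁ + a₂ + a₃ : ℤ) = a₄ + a₅ + a₆ ∧
      ⌊(N : ℝ) ^ 2 * Real.log (N + a₁)⌋ + ⌊(N : ℝ) ^ 2 * Real.log (N + a₂)⌋ +
          ⌊(N : ℝ) ^ 2 * Real.log (N + a₃)⌋ =
        ⌊(N : ℝ) ^ 2 * Real.log (N + a₄)⌋ + ⌊(N : ℝ) ^ 2 * Real.log (N + a₅)⌋ +
          ⌊(N : ℝ) ^ 2 * Real.log (N + a₆)⌋ := by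
  set G : ℕ → ℤ := fun a => ⌊(N : ℝ) ^ 2 * Real.log (N + a)⌋ with hG
  set B : ℕ := ∑ a ∈ S, (a + (G a).natAbs) with hB
  have hle : ∀ a ∈ S, a + (G a).natAbs ≤ B := fun a ha =>
    single_le_sum (f := fun a => a + (G a).natAbs) (fun _ _ => Nat.zero_le _) ha
  refine ⟨6 * B + 1, by omega, fun a₁ h₁ a₂ h₂ a₃ h₃ a₄ h₄ a₅ h₅ a₆ h₆ h => ?_⟩
  have e₁ := hle _ h₁
  have e₂ := hle _ h₂
  have e₃ := hle _ h₃
  have e₄ := hle _ h₄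
  have e₅ := hle _ h₅
  have e₆ := hle _ h₆
  have hx := congrArg Prod.fst h
  have hy := congrArg Prod.snd h
  simp only [logPoint, Prod.fst_add, Prod.snd_add, ← Int.cast_add] at hx hy
  refine ⟨int_eq_of_zmod_eq hx ?_, int_eq_of_zmod_eq hy ?_⟩
  · rw [abs_lt]
    constructor <;> push_cast <;> omega
  · change |G a₁ + G a₂ + G a₃ - (G a₄ + G a₅ + G a₆)| < _
    rw [abs_lt]
    constructor <;> push_cast <;> omega

theorem isCurved_logPoint {N M Q : ℕ} (hN : 0 < N) (hM : M ≤ N)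
    (hQ : ∀ a₁ ∈ Icc 1 M, ∀ a₂ ∈ Icc 1 M, ∀ a₃ ∈ Icc 1 M, ∀ a₄ ∈ Icc 1 M, ∀ a₅ ∈ Icc 1 M,
      ∀ a₆ ∈ Icc 1 M, logPoint N Q a₁ + logPoint N Q a₂ + logPoint N Q a₃ =
        logPoint N Q a₄ + logPoint N Q a₅ + logPoint N Q a₆ →
      (a₁ + a₂ + a₃ : ℤ) = a₄ + a₅ + a₆ ∧
      ⌊(N : ℝ) ^ 2 * Real.log (N + a₁)⌋ + ⌊(N : ℝ) ^ 2 * Real.log (N + a₂)⌋ +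
          ⌊(N : ℝ) ^ 2 * Real.log (N + a₃)⌋ =
        ⌊(N : ℝ) ^ 2 * Real.log (N + a₄)⌋ + ⌊(N : ℝ) ^ 2 * Real.log (N + a₅)⌋ +
          ⌊(N : ℝ) ^ 2 * Real.log (N + a₆)⌋) :
    IsCurved (logPoint N Q) (Icc 1 M) := by
  intro s Y hY I hI J hJ hsep hdiam a ha a' ha' b₁ h₁ b₂ h₂ b₃ h₃ b₄ h₄ h
  rcases le_total a a' with haa' | haa'
  · exact (Nat.mul_le_mul_right s haa').trans (Nat.le_add_right _ _)
  obtain ⟨hlin, hfloor⟩ := hQ a (hI ha) b₁ (hJ h₁) b₂ (hJ h₂) a' (hI ha') b₃ (hJ h₃) b₄ (hJ h₄) h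
  have hN' : (0 : ℝ) < N := by exact_mod_cast hN
  have hY' : (1 : ℝ) ≤ Y := by exact_mod_cast hY
  have hrange : ∀ x ∈ Icc 1 M, (N : ℝ) ≤ N + x ∧ (N : ℝ) + x ≤ 2 * N := by
    intro x hx
    have : (x : ℝ) ≤ N := by exact_mod_cast (mem_Icc.1 hx).2.trans hM
    have : (0 : ℝ) ≤ x := Nat.cast_nonneg x
    constructor <;> linarith
  have htan : ∀ b ∈ J, (N : ℝ) ^ 2 * (Real.log (N + b) - Real.log (N + b₁) -
      ((N + b) - (N + b₁)) / (N + b₁)) ≤ 0 ∧ -(Y : ℝ) ^ 2 ≤ (N : ℝ) ^ 2 *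
      (Real.log (N + b) - Real.log (N + b₁) - ((N + b) - (N + b₁)) / (N + b₁)) := by
    intro b hb
    obtain ⟨h5, h6⟩ := sq_mul_log_tangent hN' (hrange b (hJ hb)).1 (hrange b₁ (hJ h₁)).1
    refine ⟨h5, le_trans (neg_le_neg ?_) h6⟩
    have e1 : (b : ℝ) ≤ b₁ + Y := by exact_mod_cast hdiam b hb b₁ h₁
    have e2 : (b₁ : ℝ) ≤ b + Y := by exact_mod_cast hdiam b₁ h₁ b hb
    rw [sq_le_sq, abs_le, abs_of_nonneg (by linarith : (0 : ℝ) ≤ Y)]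
    constructor <;> linarith
  have hcurv := sq_mul_log_curvature (s := s) hN' (hrange b₁ (hJ h₁)).1 (hrange b₁ (hJ h₁)).2
    (hrange a' (hI ha')).1 (a := N + a) (by gcongr) (hrange a (hI ha)).2 (Nat.cast_nonneg s)
    (hsep.imp (fun h5 => by
        have : (b₁ + s : ℝ) ≤ a' := by exact_mod_cast h5 a' ha' b₁ h₁
        linarith) fun h5 => by
        have : (a + s : ℝ) ≤ b₁ := by exact_mod_cast h5 a ha b₁ h₁
        linarith)
  have hlin' : (a : ℝ) + b₁ + b₂ = a' + b₃ + b₄ := by exact_mod_cast hlin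
  have hfloor' := congrArg (Int.cast : ℤ → ℝ) hfloor
  push_cast at hfloor'
  have hfl : ∀ x : ℕ, (⌊(N : ℝ) ^ 2 * Real.log (N + x)⌋ : ℝ) ≤ (N : ℝ) ^ 2 * Real.log (N + x) ∧
      (N : ℝ) ^ 2 * Real.log (N + x) ≤ ⌊(N : ℝ) ^ 2 * Real.log (N + x)⌋ + 1 :=
    fun x => ⟨Int.floor_le _, (Int.lt_floor_add_one _).le⟩
  have hbound : |(N : ℝ) ^ 2 * (Real.log (N + a) - Real.log (N + a') -
      ((N + a) - (N + a')) / (N + b₁))| ≤ 2 * (Y : ℝ) ^ 2 + 3 := by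
    have hslope : ((N + a : ℝ) - (N + a')) / (N + b₁) =
        ((N + b₃) - (N + b₁)) / (N + b₁) + ((N + b₄) - (N + b₁)) / (N + b₁) -
          ((N + b₂) - (N + b₁)) / (N + b₁) := by
      rw [← add_div, ← sub_div]
      congr 1
      linarith
    rw [hslope]
    obtain ⟨t2, t2'⟩ := htan b₂ h₂
    obtain ⟨t3, t3'⟩ := htan b₃ h₃
    obtain ⟨t4, t4'⟩ := htan b₄ h₄
    obtain ⟨fa, fa'⟩ := hfl a
    obtain ⟨fa2, fa2'⟩ := hfl a'
    obtain ⟨f1, f1'⟩ := hfl b₁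
    obtain ⟨f2, f2'⟩ := hfl b₂
    obtain ⟨f3, f3'⟩ := hfl b₃
    obtain ⟨f4, f4'⟩ := hfl b₄
    rw [abs_le]
    constructor <;> linarith
  have hfin : (a : ℝ) * s ≤ a' * s + 36 * Y ^ 2 := by
    have : (1 : ℝ) ≤ Y ^ 2 := one_le_pow₀ hY'
    have := hcurv.trans hbound
    linarith
  exact_mod_cast hfin

/-- Nearly equal products of three elements of `[N, N + √N]` give nearly equal sums of the
corresponding points `(a, ⌊N² log (N + a)⌋)`. -/
theorem abs_sums_le {N R : ℕ} {A : ℝ} (hN : 1 ≤ N) (hA : 0 < A) (hR : A + 3 ≤ R)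
    {a₁ a₂ a₃ a₄ a₅ a₆ : ℕ} (h₁ : a₁ ^ 2 ≤ N) (h₂ : a₂ ^ 2 ≤ N) (h₃ : a₃ ^ 2 ≤ N)
    (h₄ : a₄ ^ 2 ≤ N) (h₅ : a₅ ^ 2 ≤ N) (h₆ : a₆ ^ 2 ≤ N)
    (h : |((N + a₁ : ℝ) * (N + a₂) * (N + a₃)) - (N + a₄) * (N + a₅) * (N + a₆)| ≤ A * N) :
    |(a₁ + a₂ + a₃ : ℤ) - (a₄ + a₅ + a₆)| ≤ R ∧
    |⌊(N : ℝ) ^ 2 * Real.log (N + a₁)⌋ + ⌊(N : ℝ) ^ 2 * Real.log (N + a₂)⌋ +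
          ⌊(N : ℝ) ^ 2 * Real.log (N + a₃)⌋ -
        (⌊(N : ℝ) ^ 2 * Real.log (N + a₄)⌋ + ⌊(N : ℝ) ^ 2 * Real.log (N + a₅)⌋ +
          ⌊(N : ℝ) ^ 2 * Real.log (N + a₆)⌋)| ≤ R := by
  have hN' : (1 : ℝ) ≤ N := by exact_mod_cast hN
  have hN0 : (0 : ℝ) < N := by linarith
  have hge : ∀ a : ℕ, (N : ℝ) ≤ N + a := fun a => by
    have : (0 : ℝ) ≤ a := Nat.cast_nonneg a
    linarith
  have hlog : ∀ a b c : ℕ, Real.log ((N + a) * (N + b) * (N + c)) =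
      Real.log (N + a) + Real.log (N + b) + Real.log (N + c) := by
    intro a b c
    have := hge a
    have := hge b
    have := hge c
    rw [Real.log_mul (by positivity) (by positivity), Real.log_mul (by positivity) (by positivity)]
  have hcube : ∀ a b c : ℕ, (N : ℝ) ^ 3 ≤ (N + a) * (N + b) * (N + c) := by
    intro a b c
    calc (N : ℝ) ^ 3 = N * N * N := by ring
      _ ≤ _ := by gcongr <;> exact hge _
  have hprod : ∀ x y : ℝ, (N : ℝ) ^ 3 ≤ x → (N : ℝ) ^ 3 ≤ y → |x - y| ≤ A * N →
      (N : ℝ) ^ 2 * (Real.log x - Real.log y) ≤ A := by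
    intro x y hx hy hxy
    have h3 : (0 : ℝ) < N ^ 3 := by positivity
    calc _ ≤ (N : ℝ) ^ 2 * ((x - y) / y) := by
          gcongr
          exact log_sub_log_le (by linarith) (by linarith)
      _ ≤ (N : ℝ) ^ 2 * (A * N / N ^ 3) := by
          gcongr
          exact (le_abs_self _).trans hxy
      _ = A := by field_simp
  have hd1 := hprod _ _ (hcube a₁ a₂ a₃) (hcube a₄ a₅ a₆) h
  have hd2 := hprod _ _ (hcube a₄ a₅ a₆) (hcube a₁ a₂ a₃) (by rwa [abs_sub_comm])
  rw [hlog, hlog] at hd1 hd2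
  constructor
  · have htan : ∀ a : ℕ, a ^ 2 ≤ N →
        (N : ℝ) ^ 2 * Real.log (N + a) - N ^ 2 * Real.log N - N * a ≤ 0 ∧
        -(N : ℝ) ≤ (N : ℝ) ^ 2 * Real.log (N + a) - N ^ 2 * Real.log N - N * a := by
      intro a ha
      have ha' : (a : ℝ) ^ 2 ≤ N := by exact_mod_cast ha
      obtain ⟨h7, h8⟩ := sq_mul_log_tangent hN0 (hge a) le_rfl
      have e : (N : ℝ) ^ 2 * (Real.log (N + a) - Real.log N - (N + a - N) / N) =
          (N : ℝ) ^ 2 * Real.log (N + a) - N ^ 2 * Real.log N - N * a := by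
        field_simp
        ring
      rw [e] at h7 h8
      rw [add_sub_cancel_left] at h8
      exact ⟨h7, by linarith⟩
    obtain ⟨t1, t1'⟩ := htan a₁ h₁
    obtain ⟨t2, t2'⟩ := htan a₂ h₂
    obtain ⟨t3, t3'⟩ := htan a₃ h₃
    obtain ⟨t4, t4'⟩ := htan a₄ h₄
    obtain ⟨t5, t5'⟩ := htan a₅ h₅
    obtain ⟨t6, t6'⟩ := htan a₆ h₆
    have hAN : A + 3 * N ≤ N * R := by nlinarith
    have hreal : |(a₁ + a₂ + a₃ : ℝ) - (a₄ + a₅ + a₆)| ≤ R := by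
      rw [abs_le]
      constructor
      · refine le_of_mul_le_mul_left ?_ hN0
        linarith
      · refine le_of_mul_le_mul_left ?_ hN0
        linarith
    exact_mod_cast hreal
  · have hfl : ∀ x : ℕ,
        (⌊(N : ℝ) ^ 2 * Real.log (N + x)⌋ : ℝ) ≤ (N : ℝ) ^ 2 * Real.log (N + x) ∧
        (N : ℝ) ^ 2 * Real.log (N + x) ≤ ⌊(N : ℝ) ^ 2 * Real.log (N + x)⌋ + 1 :=
      fun x => ⟨Int.floor_le _, (Int.lt_floor_add_one _).le⟩
    obtain ⟨f1, f1'⟩ := hfl a₁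
    obtain ⟨f2, f2'⟩ := hfl a₂
    obtain ⟨f3, f3'⟩ := hfl a₃
    obtain ⟨f4, f4'⟩ := hfl a₄
    obtain ⟨f5, f5'⟩ := hfl a₅
    obtain ⟨f6, f6'⟩ := hfl a₆
    have hreal : |(⌊(N : ℝ) ^ 2 * Real.log (N + a₁)⌋ + ⌊(N : ℝ) ^ 2 * Real.log (N + a₂)⌋ +
          ⌊(N : ℝ) ^ 2 * Real.log (N + a₃)⌋ : ℝ) -
        (⌊(N : ℝ) ^ 2 * Real.log (N + a₄)⌋ + ⌊(N : ℝ) ^ 2 * Real.log (N + a₅)⌋ +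
          ⌊(N : ℝ) ^ 2 * Real.log (N + a₆)⌋)| ≤ R := by
      rw [abs_le]
      constructor <;> linarith
    exact_mod_cast hreal

theorem card_logPoint_le {N : ℕ} {θ : ℝ} (hθ : 1 ≤ θ) {n : ℕ}
    (hn : 64 * 256 ^ 12 * 18433 ^ 2 ≤ θ ^ n) {m : ℕ} (hm : Nat.sqrt N < 256 ^ m) {Q : ℕ}
    (hQ0 : 0 < Q) (hv : IsCurved (logPoint N Q) (Icc 1 (Nat.sqrt N)))
    (x : ZMod Q × ZMod Q) :
    (#{z ∈ (Icc 1 (Nat.sqrt N) ×ˢ Icc 1 (Nat.sqrt N) ×ˢ Icc 1 (Nat.sqrt N)) ×ˢ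
        (Icc 1 (Nat.sqrt N) ×ˢ Icc 1 (Nat.sqrt N) ×ˢ Icc 1 (Nat.sqrt N)) |
      (logPoint N Q z.1.1 + logPoint N Q z.1.2.1 + logPoint N Q z.1.2.2) -
        (logPoint N Q z.2.1 + logPoint N Q z.2.2.1 + logPoint N Q z.2.2.2) = x} : ℝ) ≤
      256 ^ (6 * 2 ^ (n + 1)) * (256 ^ 3 * θ) ^ m := by
  have : NeZero Q := ⟨hQ0.ne'⟩
  have h1 := card_triples_le_sixthMoment (logPoint N Q) (Icc 1 (Nat.sqrt N)) x
  have h2 := hv.sixthMoment_block_le hθ hn m 0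
  have hblock : block (Icc 1 (Nat.sqrt N)) m 0 = Icc 1 (Nat.sqrt N) := by
    refine filter_true_of_mem fun a ha => Nat.div_eq_of_lt ?_
    exact (mem_Icc.1 ha).2.trans_lt hm
  rw [hblock] at h2
  have hcard : (0 : ℝ) < Fintype.card (ZMod Q × ZMod Q) := by
    exact_mod_cast Fintype.card_pos
  refine le_of_mul_le_mul_left ?_ hcard
  refine (h1.trans h2).trans (le_of_eq ?_)
  ring

end Logarithm

theorem ncard_triple_products_le {A : ℝ} (hA : 0 < A) {R : ℕ} (hR : A + 3 ≤ R) {N : ℕ}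
    (hN : 2 ≤ N) {θ : ℝ} (hθ : 1 ≤ θ) {n : ℕ} (hn : 64 * 256 ^ 12 * 18433 ^ 2 ≤ θ ^ n) {m : ℕ}
    (hm : Nat.sqrt N < 256 ^ m) :
    (Set.ncard {t : Fin 6 → ℕ |
          (∀ i, N + 1 ≤ t i ∧ t i ≤ N + Nat.sqrt N) ∧
          |((t 0 * t 1 * t 2 : ℕ) : ℝ) - ((t 3 * t 4 * t 5 : ℕ) : ℝ)| ≤ A * N} : ℝ) ≤
      (2 * R + 1) ^ 2 * (256 ^ (6 * 2 ^ (n + 1)) * (256 ^ 3 * θ) ^ m) := by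
  set S := Icc 1 (Nat.sqrt N) with hS
  obtain ⟨Q, hQ0, hQ⟩ := exists_modulus N S
  have hv : IsCurved (logPoint N Q) S := isCurved_logPoint (by omega) (Nat.sqrt_le_self N) hQ
  set U : ZMod Q × ZMod Q → Finset ((ℕ × ℕ × ℕ) × ℕ × ℕ × ℕ) := fun x =>
    {z ∈ (S ×ˢ S ×ˢ S) ×ˢ (S ×ˢ S ×ˢ S) |
      (logPoint N Q z.1.1 + logPoint N Q z.1.2.1 + logPoint N Q z.1.2.2) -
        (logPoint N Q z.2.1 + logPoint N Q z.2.2.1 + logPoint N Q z.2.2.2) = x} with hU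
  set box : Finset (ℤ × ℤ) := Icc (-(R : ℤ)) R ×ˢ Icc (-(R : ℤ)) R with hbox
  set W := box.biUnion fun p => U ((p.1 : ZMod Q), (p.2 : ZMod Q)) with hW
  have hWcard : (#W : ℝ) ≤ (2 * R + 1) ^ 2 * (256 ^ (6 * 2 ^ (n + 1)) * (256 ^ 3 * θ) ^ m) := by
    calc (#W : ℝ) ≤ ∑ p ∈ box, (#(U ((p.1 : ZMod Q), (p.2 : ZMod Q))) : ℝ) := by
          exact_mod_cast card_biUnion_le
      _ ≤ ∑ p ∈ box, 256 ^ (6 * 2 ^ (n + 1)) * (256 ^ 3 * θ) ^ m :=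
          sum_le_sum fun p _ => card_logPoint_le hθ hn hm hQ0 hv _
      _ = _ := by
          have : #box = (2 * R + 1) ^ 2 := by
            rw [hbox, card_product, Int.card_Icc, sq]
            congr 1 <;> omega
          rw [sum_const, nsmul_eq_mul, this]
          push_cast
          ring
  refine le_trans ?_ hWcard
  norm_cast
  rw [← Set.ncard_coe_finset W]
  refine Set.ncard_le_ncard_of_injOn
    (fun t => ((t 0 - N, t 1 - N, t 2 - N), (t 3 - N, t 4 - N, t 5 - N))) ?_ ?_ (finite_toSet W)
  · rintro t ⟨ht, hprod⟩
    obtain ⟨a, rfl⟩ : ∃ a : Fin 6 → ℕ, t = fun i => N + a i :=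
      ⟨fun i => t i - N, funext fun i => (Nat.add_sub_cancel' ((Nat.le_succ N).trans (ht i).1)).symm⟩
    have haS : ∀ i, a i ∈ S := fun i => by
      have h : N + 1 ≤ N + a i ∧ N + a i ≤ N + Nat.sqrt N := ht i
      rw [hS, mem_Icc]
      omega
    have hsq : ∀ i, a i ^ 2 ≤ N := fun i => by
      have h1 := (mem_Icc.1 (haS i)).2
      have h2 := Nat.sqrt_le' N
      exact (Nat.pow_le_pow_left h1 2).trans h2
    push_cast at hprod
    obtain ⟨h1, h2⟩ := abs_sums_le (by omega) hA hR (hsq 0) (hsq 1) (hsq 2) (hsq 3) (hsq 4)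
      (hsq 5) hprod
    simp only [Nat.add_sub_cancel_left]
    rw [hW, mem_coe, mem_biUnion]
    refine ⟨(_, _), mem_product.2 ⟨mem_Icc.2 (abs_le.1 h1), mem_Icc.2 (abs_le.1 h2)⟩, ?_⟩
    refine mem_filter.2 ⟨by simp only [mem_product, haS, and_self], ?_⟩
    simp only [logPoint]
    push_cast
    rfl
  · rintro t ⟨ht, -⟩ t' ⟨ht', -⟩ h
    simp only [Prod.mk.injEq] at h
    have key : ∀ i, t i - N = t' i - N := by
      intro i
      fin_cases i <;> simp [h]
    funext i
    have := key i
    have := ht i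
    have := ht' i
    omega

/-- the number of 6-tuples of integers `n_i ∈ [N+1, N+⌊N^{1/2}⌋]` with
`|n₁n₂n₃ − n₄n₅n₆| ≤ A·N` is at most `C_{ε,A} N^{3/2+ε}`. -/
theorem count_triple_products (A ε : ℝ) (hA : 0 < A) (hε : 0 < ε) :
    ∃ C : ℝ, 0 < C ∧ ∀ N : ℕ, 2 ≤ N →
      (Set.ncard {t : Fin 6 → ℕ |
          (∀ i, N + 1 ≤ t i ∧ t i ≤ N + Nat.sqrt N) ∧
          |((t 0 * t 1 * t 2 : ℕ) : ℝ) - ((t 3 * t 4 * t 5 : ℕ) : ℝ)| ≤ A * N} : ℝ) ≤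
        C * (N : ℝ) ^ ((3 : ℝ) / 2 + ε) := by
  obtain ⟨R, hR⟩ := exists_nat_ge (A + 3)
  have hθ : (1 : ℝ) < 256 ^ (2 * ε) := Real.one_lt_rpow (by norm_num) (by positivity)
  obtain ⟨n, hn⟩ := pow_unbounded_of_one_lt (64 * 256 ^ 12 * 18433 ^ 2 : ℝ) hθ
  have hw : (256 : ℝ) ^ 3 * 256 ^ (2 * ε) = 256 ^ (3 + 2 * ε) := by
    rw [Real.rpow_add (by norm_num)]
    norm_num
  refine ⟨(2 * R + 1) ^ 2 * (256 ^ (6 * 2 ^ (n + 1)) * 256 ^ (3 + 2 * ε)), by positivity,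
    fun N hN => ?_⟩
  set M := Nat.sqrt N with hM
  have hM0 : M ≠ 0 := (Nat.sqrt_pos.2 (by omega)).ne'
  have h := ncard_triple_products_le hA hR hN hθ.le hn.le
    (Nat.lt_pow_succ_log_self (b := 256) (by norm_num) M)
  refine h.trans ?_
  rw [hw]
  have hlog : ((256 : ℝ) ^ (3 + 2 * ε)) ^ Nat.log 256 M ≤ (N : ℝ) ^ ((3 : ℝ) / 2 + ε) := by
    have h1 : ((256 : ℝ) ^ Nat.log 256 M) ≤ M := by exact_mod_cast Nat.pow_log_le_self 256 hM0
    have h2 : (M : ℝ) ≤ (N : ℝ) ^ (1 / 2 : ℝ) := by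
      rw [← Real.sqrt_eq_rpow]
      exact Real.nat_sqrt_le_real_sqrt
    calc _ = ((256 : ℝ) ^ Nat.log 256 M) ^ (3 + 2 * ε) := by
          rw [← Real.rpow_natCast, ← Real.rpow_natCast, ← Real.rpow_mul (by norm_num),
            ← Real.rpow_mul (by norm_num), mul_comm]
      _ ≤ ((N : ℝ) ^ (1 / 2 : ℝ)) ^ (3 + 2 * ε) :=
          Real.rpow_le_rpow (by positivity) (h1.trans h2) (by positivity)
      _ = _ := by
          rw [← Real.rpow_mul (Nat.cast_nonneg N)]
          congr 1
          ring
  calc _ = (2 * R + 1) ^ 2 * (256 ^ (6 * 2 ^ (n + 1)) * 256 ^ (3 + 2 * ε)) *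
        ((256 : ℝ) ^ (3 + 2 * ε)) ^ Nat.log 256 M := by
        rw [Nat.succ_eq_add_one, pow_succ ((256 : ℝ) ^ (3 + 2 * ε))]
        generalize (256 : ℝ) ^ (3 + 2 * ε) = w
        ring
    _ ≤ _ := mul_le_mul_of_nonneg_left hlog (by positivity)
end

section
/- Let {a_n}_{n=1}^{N} be a generalized Dirichlet sequence with parameter θ = 1, i.e. a_2 − a_1 ∈ [1/(4N), 4/N] and (a_{i+2} − a_{i+1}) − (a_{i+1} − a_i) ∈ [1/(4N²), 4/N²] for all 1 ≤ i ≤ N−2, and let a = N^{-α} with α ∈ [0,2]. Then: (1) if α ∈ [0, 1/2], the number of n ∈ [1,N] with a_n ∈ aℤ is at most C N^α for an absolute constant C; (2) if α ∈ [1/2, 2], then for every ε > 0 the number of n ∈ [1,N] with a_n ∈ aℤ is at most C_ε N^{1/3 + α/3 + ε}. -/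
/-- `{a_n}_{n=1}^{N}` is a generalized Dirichlet sequence with parameter `θ = 1`. -/
def GDSone (N : ℕ) (a : ℕ → ℝ) : Prop :=
  a 2 - a 1 ∈ Set.Icc (1 / (4 * (N : ℝ))) (4 / (N : ℝ)) ∧
  ∀ i : ℕ, 1 ≤ i → i + 2 ≤ N →
    (a (i + 2) - a (i + 1)) - (a (i + 1) - a i) ∈
      Set.Icc (1 / (4 * (N : ℝ) ^ 2)) (4 / (N : ℝ) ^ 2)

open Finset in
/-- Markov's inequality for finite sums. -/
theorem card_filter_mul_le_sum {ι : Type*} (s : Finset ι) (f : ι → ℝ) (t : ℝ)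
    (hf : ∀ i ∈ s, 0 ≤ f i) : (#{i ∈ s | t ≤ f i} : ℝ) * t ≤ ∑ i ∈ s, f i := by
  calc (#{i ∈ s | t ≤ f i} : ℝ) * t = ∑ i ∈ s with t ≤ f i, t := by simp
    _ ≤ ∑ i ∈ s with t ≤ f i, f i := sum_le_sum fun i hi => (mem_filter.1 hi).2
    _ ≤ ∑ i ∈ s, f i := sum_le_sum_of_subset_of_nonneg (filter_subset _ _) fun i hi _ => hf i hi

open Finset in
/-- A family of distinct integer vectors with positive coordinates whose coordinate sums are at
most `A` and `B` has at most `(32 A B)^{1/3}` members. -/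
theorem card_pow_three_le {ι : Type*} (s : Finset ι) (u v : ι → ℤ) (A B : ℝ)
    (hinj : Set.InjOn (fun i => (u i, v i)) s) (hu : ∀ i ∈ s, 0 < u i) (hv : ∀ i ∈ s, 0 < v i)
    (hA : ∑ i ∈ s, (u i : ℝ) ≤ A) (hB : ∑ i ∈ s, (v i : ℝ) ≤ B) :
    (#s : ℝ) ^ 3 ≤ 32 * (A * B) := by
  have hu' : ∀ i ∈ s, (0 : ℝ) ≤ u i := fun i hi => by exact_mod_cast (hu i hi).le
  have hv' : ∀ i ∈ s, (0 : ℝ) ≤ v i := fun i hi => by exact_mod_cast (hv i hi).le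
  have hA0 : 0 ≤ A := (sum_nonneg hu').trans hA
  have hB0 : 0 ≤ B := (sum_nonneg hv').trans hB
  obtain hs | hs := s.eq_empty_or_nonempty
  · subst hs
    simpa using mul_nonneg hA0 hB0
  have hM : (0 : ℝ) < #s := by exact_mod_cast hs.card_pos
  set M : ℝ := (#s : ℝ) with hM_def
  have hApos : 0 < A := (sum_pos (fun i hi => by exact_mod_cast hu i hi) hs).trans_le hA
  have hBpos : 0 < B := (sum_pos (fun i hi => by exact_mod_cast hv i hi) hs).trans_le hB
  have large (w : ι → ℤ) (T : ℝ) (hT : 0 < T) (hw : ∀ i ∈ s, (0 : ℝ) ≤ w i)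
      (hsum : ∑ i ∈ s, (w i : ℝ) ≤ T) : (#{i ∈ s | 4 * T / M ≤ (w i : ℝ)} : ℝ) ≤ M / 4 := by
    have h := (card_filter_mul_le_sum s (fun i => (w i : ℝ)) (4 * T / M) hw).trans hsum
    rw [mul_div_assoc', div_le_iff₀ hM] at h
    rw [le_div_iff₀ (by norm_num)]
    nlinarith
  set P := s.filter fun i => 4 * A / M ≤ (u i : ℝ)
  set Q := s.filter fun i => 4 * B / M ≤ (v i : ℝ)
  set R := s.filter fun i => (u i : ℝ) < 4 * A / M ∧ (v i : ℝ) < 4 * B / M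
  have hP : (#P : ℝ) ≤ M / 4 := large u A hApos hu' hA
  have hQ : (#Q : ℝ) ≤ M / 4 := large v B hBpos hv' hB
  have hR : (#R : ℝ) ≤ (4 * A / M) * (4 * B / M) := by
    have hsub : #R ≤ #(Icc (1 : ℤ) ⌊4 * A / M⌋ ×ˢ Icc (1 : ℤ) ⌊4 * B / M⌋) := by
      refine card_le_card_of_injOn (fun i => (u i, v i)) (fun i hi => ?_)
        (hinj.mono (by exact_mod_cast filter_subset _ s))
      obtain ⟨his, h1, h2⟩ := mem_filter.1 (mem_coe.1 hi)
      have := hu i his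
      have := hv i his
      simp only [coe_product, Set.mem_prod, coe_Icc, Set.mem_Icc, Int.le_floor]
      exact ⟨⟨by omega, h1.le⟩, ⟨by omega, h2.le⟩⟩
    have hfl (x : ℝ) (hx : 0 ≤ x) : ((⌊x⌋.toNat : ℕ) : ℝ) ≤ x := by
      rw [Int.floor_toNat]
      exact Nat.floor_le hx
    rw [card_product, Int.card_Icc, Int.card_Icc, add_sub_cancel_right,
      add_sub_cancel_right] at hsub
    calc (#R : ℝ) ≤ (⌊4 * A / M⌋.toNat : ℝ) * (⌊4 * B / M⌋.toNat : ℝ) := by exact_mod_cast hsub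
      _ ≤ _ := by gcongr <;> exact hfl _ (by positivity)
  have hcover : M ≤ #P + #Q + #R := by
    have : #s ≤ #P + #Q + #R := by
      classical
      refine (card_le_card (t := P ∪ Q ∪ R) fun i hi => ?_).trans
        ((card_union_le _ _).trans (Nat.add_le_add_right (card_union_le _ _) _))
      simp only [P, Q, R, mem_union, mem_filter, hi, true_and]
      by_cases h1 : 4 * A / M ≤ (u i : ℝ)
      · simp [h1]
      · by_cases h2 : 4 * B / M ≤ (v i : ℝ)
        · simp [h2]
        · exact Or.inr ⟨not_le.1 h1, not_le.1 h2⟩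
    rw [hM_def]
    exact_mod_cast this
  have hhalf : M / 2 ≤ 16 * (A * B) / M ^ 2 := by
    have : (4 * A / M) * (4 * B / M) = 16 * (A * B) / M ^ 2 := by field_simp; ring
    linarith
  rw [le_div_iff₀ (by positivity)] at hhalf
  nlinarith

namespace GDSone

variable {N : ℕ} {a : ℕ → ℝ}

theorem diff_bounds (h : GDSone N a) (hN : 2 ≤ N) (i : ℕ) (hi : i + 2 ≤ N) :
    0 < a (i + 2) - a (i + 1) ∧ a (i + 2) - a (i + 1) ≤ 4 / N + i * (4 / (N : ℝ) ^ 2) := by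
  have hN0 : (0 : ℝ) < N := by exact_mod_cast (by omega : 0 < N)
  induction i with
  | zero =>
    have h1 := h.1
    have : (0 : ℝ) < 1 / (4 * N) := by positivity
    refine ⟨by simpa using this.trans_le h1.1, by simpa using h1.2⟩
  | succ i ih =>
    obtain ⟨h1, h2⟩ := ih (by omega)
    obtain ⟨h3, h4⟩ := h.2 (i + 1) (by omega) (by omega)
    have : (0 : ℝ) < 1 / (4 * (N : ℝ) ^ 2) := by positivity
    simp only [add_assoc, Nat.reduceAdd] at h1 h2 h3 h4 ⊢
    push_cast
    constructor <;> linarith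

theorem diff_pos (h : GDSone N a) (hN : 2 ≤ N) {i : ℕ} (hi : 1 ≤ i) (hiN : i < N) :
    0 < a (i + 1) - a i := by
  obtain ⟨j, rfl⟩ := Nat.exists_eq_add_of_le' hi
  exact (h.diff_bounds hN j (by omega)).1

theorem diff_le (h : GDSone N a) (hN : 2 ≤ N) {i : ℕ} (hi : 1 ≤ i) (hiN : i < N) :
    a (i + 1) - a i ≤ 8 / N := by
  obtain ⟨j, rfl⟩ := Nat.exists_eq_add_of_le' hi
  refine (h.diff_bounds hN j (by omega)).2.trans ?_
  have hN0 : (0 : ℝ) < N := by exact_mod_cast (by omega : 0 < N)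
  have hj : (j : ℝ) ≤ N := by exact_mod_cast (by omega : j ≤ N)
  calc (4 : ℝ) / N + j * (4 / (N : ℝ) ^ 2) ≤ 4 / N + (N : ℝ) * (4 / (N : ℝ) ^ 2) := by gcongr
    _ = 8 / (N : ℝ) := by field_simp; norm_num

theorem diff_lt_diff (h : GDSone N a) (hN : 2 ≤ N) {i j : ℕ} (hi : 1 ≤ i) (hij : i < j)
    (hj : j < N) : a (i + 1) - a i < a (j + 1) - a j := by
  have hN0 : (0 : ℝ) < N := by exact_mod_cast (by omega : 0 < N)
  have hpos : (0 : ℝ) < 1 / (4 * (N : ℝ) ^ 2) := by positivity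
  have step : ∀ k, 1 ≤ k → k + 2 ≤ N → a (k + 1) - a k < a (k + 1 + 1) - a (k + 1) := by
    intro k hk hkN
    have := (h.2 k hk hkN).1
    linarith
  induction j, hij using Nat.le_induction with
  | base => exact step i hi (by omega)
  | succ j hij ih => exact (ih (by omega)).trans (step j (by omega) (by omega))

theorem sub_eq_sum_Ico {p q : ℕ} (hpq : p ≤ q) :
    a q - a p = ∑ k ∈ Finset.Ico p q, (a (k + 1) - a k) :=
  (Finset.sum_Ico_sub a hpq).symm

theorem lt_of_lt (h : GDSone N a) (hN : 2 ≤ N) {p q : ℕ} (hp : 1 ≤ p) (hpq : p < q)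
    (hq : q ≤ N) : a p < a q := by
  rw [← sub_pos, sub_eq_sum_Ico hpq.le]
  refine Finset.sum_pos (fun k hk => ?_) (Finset.nonempty_Ico.2 hpq)
  rw [Finset.mem_Ico] at hk
  exact h.diff_pos hN (by omega) (by omega)

theorem sub_le_eight (h : GDSone N a) (hN : 2 ≤ N) {p q : ℕ} (hp : 1 ≤ p) (hpq : p ≤ q)
    (hq : q ≤ N) : a q - a p ≤ 8 := by
  have hN0 : (0 : ℝ) < N := by exact_mod_cast (by omega : 0 < N)
  have hle : a q - a p ≤ (q - p : ℕ) * (8 / (N : ℝ)) := by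
    rw [sub_eq_sum_Ico hpq, ← nsmul_eq_mul, ← Nat.card_Ico]
    refine Finset.sum_le_card_nsmul _ _ _ fun k hk => ?_
    rw [Finset.mem_Ico] at hk
    exact h.diff_le hN (by omega) (by omega)
  have hlen : ((q - p : ℕ) : ℝ) ≤ N := by exact_mod_cast (by omega : q - p ≤ N)
  calc a q - a p ≤ (q - p : ℕ) * (8 / (N : ℝ)) := hle
    _ ≤ N * (8 / (N : ℝ)) := by gcongr
    _ = 8 := by field_simp

/-- By strict convexity, increments over two successive intervals of equal length differ. -/
theorem sub_lt_sub (h : GDSone N a) (hN : 2 ≤ N) {p q r s : ℕ} (hp : 1 ≤ p) (hpq : p < q)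
    (hqr : q ≤ r) (hs : s ≤ N) (hlen : q - p = s - r) : a q - a p < a s - a r := by
  have hrs : r < s := by omega
  rw [sub_eq_sum_Ico hpq.le, sub_eq_sum_Ico hrs.le, Finset.sum_Ico_eq_sum_range,
    Finset.sum_Ico_eq_sum_range, hlen]
  refine Finset.sum_lt_sum_of_nonempty (Finset.nonempty_range_iff.2 (by omega)) fun k hk => ?_
  rw [Finset.mem_range] at hk
  exact h.diff_lt_diff hN (by omega) (by omega) (by omega)

/-- Enumerating increasingly the terms in `N^{-α}ℤ` bounds their number linearly and, since the
gap vectors are distinct by convexity, also through `card_pow_three_le`. -/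
theorem card_bounds (h : GDSone N a) (hN : 2 ≤ N) (α : ℝ) :
    ∃ M : ℕ, Set.ncard {n : ℕ | 1 ≤ n ∧ n ≤ N ∧ ∃ m : ℤ, a n = (m : ℝ) * (N : ℝ) ^ (-α)} ≤ M + 1 ∧
      (M : ℝ) ≤ 8 * (N : ℝ) ^ α ∧ (M : ℝ) ^ 3 ≤ 256 * (N : ℝ) ^ (1 + α) := by
  have hN0 : (0 : ℝ) < N := by exact_mod_cast (by omega : 0 < N)
  have hNα : (0 : ℝ) < (N : ℝ) ^ α := by positivity
  set S := {n : ℕ | 1 ≤ n ∧ n ≤ N ∧ ∃ m : ℤ, a n = (m : ℝ) * (N : ℝ) ^ (-α)}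
  have hfin : S.Finite := (Set.finite_Icc 1 N).subset fun n hn => ⟨hn.1, hn.2.1⟩
  obtain hcard | hcard := Nat.eq_zero_or_pos S.ncard
  · exact ⟨0, by omega, by simpa using hNα.le, by simp; positivity⟩
  refine ⟨S.ncard - 1, by omega, ?_⟩
  set M := S.ncard - 1 with hM
  set e : ℕ → ℕ := Nat.nth (· ∈ S)
  have hcard' : hfin.toFinset.card = M + 1 := by
    rw [← Set.ncard_eq_toFinset_card S hfin]; omega
  have hmem : ∀ i, i ≤ M → e i ∈ S := fun i hi =>
    Nat.nth_mem_of_lt_card (p := (· ∈ S)) hfin (by change i < hfin.toFinset.card; omega)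
  have hmono : ∀ i j, i < j → j ≤ M → e i < e j := fun i j hij hj =>
    Nat.nth_lt_nth_of_lt_card (p := (· ∈ S)) hfin hij (by change j < hfin.toFinset.card; omega)
  have hmono' : ∀ i j, i ≤ j → j ≤ M → e i ≤ e j := fun i j hij hj => by
    obtain rfl | hlt := hij.eq_or_lt
    · exact le_rfl
    · exact (hmono i j hlt hj).le
  have hex : ∀ i, ∃ m : ℤ, i ≤ M → (m : ℝ) = a (e i) * (N : ℝ) ^ α := by
    intro i
    by_cases hi : i ≤ M
    · obtain ⟨m, hm⟩ := (hmem i hi).2.2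
      refine ⟨m, fun _ => ?_⟩
      rw [hm, mul_assoc, ← Real.rpow_add hN0]
      simp
    · exact ⟨0, fun h => absurd h hi⟩
  choose k hk using hex
  set u : ℕ → ℤ := fun i => (e (i + 1) : ℤ) - e i with hu
  set v : ℕ → ℤ := fun i => k (i + 1) - k i with hv
  have hveq : ∀ i < M, (v i : ℝ) = (a (e (i + 1)) - a (e i)) * (N : ℝ) ^ α := by
    intro i hi
    simp only [hv]
    push_cast
    rw [hk (i + 1) hi, hk i hi.le]
    ring
  have hupos : ∀ i ∈ Finset.range M, 0 < u i := by
    intro i hi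
    have := hmono i (i + 1) (by omega) (by simpa using hi)
    simp only [hu]
    omega
  have hvpos : ∀ i ∈ Finset.range M, 0 < v i := by
    intro i hi
    have hi' : i < M := by simpa using hi
    have : (0 : ℝ) < v i := by
      rw [hveq i hi']
      exact mul_pos (sub_pos.2 (h.lt_of_lt hN (hmem i hi'.le).1 (hmono i (i + 1) (by omega) hi')
        (hmem (i + 1) hi').2.1)) hNα
    exact_mod_cast this
  have hne : ∀ i j, i < j → j < M → (u i, v i) ≠ (u j, v j) := by
    intro i j hij hj heq
    obtain ⟨h1, h2⟩ := Prod.mk.inj heq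
    have l1 := hmono i (i + 1) (by omega) (by omega)
    have l2 := hmono' (i + 1) j hij hj.le
    have l3 := hmono j (j + 1) (by omega) hj
    have hlt := h.sub_lt_sub hN (hmem i (by omega)).1 l1 l2 (hmem (j + 1) hj).2.1
      (by simp only [hu] at h1; omega)
    have h3 : (v i : ℝ) = v j := by rw [h2]
    rw [hveq i (by omega), hveq j hj] at h3
    exact (mul_lt_mul_of_pos_right hlt hNα).ne h3
  have hinj : Set.InjOn (fun i => (u i, v i)) (Finset.range M) := by
    intro i hi j hj heq
    simp only [Finset.coe_range, Set.mem_Iio] at hi hj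
    obtain hlt | rfl | hlt := lt_trichotomy i j
    · exact absurd heq (hne i j hlt hj)
    · rfl
    · exact absurd heq.symm (hne j i hlt hi)
  have hsumu : ∑ i ∈ Finset.range M, (u i : ℝ) ≤ N := by
    have : ∑ i ∈ Finset.range M, u i = (e M : ℤ) - e 0 :=
      Finset.sum_range_sub (fun i => (e i : ℤ)) M
    have hle := (hmem M le_rfl).2.1
    exact_mod_cast (by omega : ∑ i ∈ Finset.range M, u i ≤ N)
  have hsumv : ∑ i ∈ Finset.range M, (v i : ℝ) ≤ 8 * (N : ℝ) ^ α := by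
    have h1 : ∑ i ∈ Finset.range M, (v i : ℝ) = (k M : ℝ) - k 0 := by
      simp only [hv]
      push_cast
      exact Finset.sum_range_sub (fun i => (k i : ℝ)) M
    rw [h1, hk M le_rfl, hk 0 (Nat.zero_le M), ← sub_mul]
    gcongr
    exact h.sub_le_eight hN (hmem 0 (Nat.zero_le M)).1 (hmono' 0 M (Nat.zero_le M) le_rfl)
      (hmem M le_rfl).2.1
  refine ⟨?_, ?_⟩
  · refine le_trans ?_ hsumv
    have : (Finset.range M).card • (1 : ℝ) ≤ ∑ i ∈ Finset.range M, (v i : ℝ) :=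
      Finset.card_nsmul_le_sum _ _ _ fun i hi => by exact_mod_cast hvpos i hi
    simpa using this
  · have := card_pow_three_le (Finset.range M) u v N (8 * (N : ℝ) ^ α) hinj hupos hvpos hsumu hsumv
    rw [Finset.card_range] at this
    rw [Real.rpow_add hN0, Real.rpow_one]
    linarith

end GDSone

/-- bounds on the intersection of a generalized Dirichlet sequence with
the arithmetic progression `N^{-α}ℤ`: at most `C N^α` terms if `α ∈ [0,1/2]`, and at
most `C_ε N^{1/3+α/3+ε}` terms if `α ∈ [1/2,2]`. -/
theorem AP_intersection_bound :
    (∃ C : ℝ, 0 < C ∧ ∀ (N : ℕ) (a : ℕ → ℝ) (α : ℝ),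
        2 ≤ N → GDSone N a → 0 ≤ α → α ≤ 1 / 2 →
        (Set.ncard {n : ℕ | 1 ≤ n ∧ n ≤ N ∧ ∃ m : ℤ, a n = (m : ℝ) * (N : ℝ) ^ (-α)} : ℝ) ≤
          C * (N : ℝ) ^ α) ∧
    (∀ ε : ℝ, 0 < ε → ∃ Cε : ℝ, 0 < Cε ∧ ∀ (N : ℕ) (a : ℕ → ℝ) (α : ℝ),
        2 ≤ N → GDSone N a → 1 / 2 ≤ α → α ≤ 2 →
        (Set.ncard {n : ℕ | 1 ≤ n ∧ n ≤ N ∧ ∃ m : ℤ, a n = (m : ℝ) * (N : ℝ) ^ (-α)} : ℝ) ≤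
          Cε * (N : ℝ) ^ ((1 : ℝ) / 3 + α / 3 + ε)) := by
  refine ⟨⟨9, by norm_num, fun N a α hN h hα _ => ?_⟩,
    fun ε hε => ⟨8, by norm_num, fun N a α hN h hα _ => ?_⟩⟩
  · obtain ⟨M, hcard, hM, -⟩ := h.card_bounds hN α
    have hone : (1 : ℝ) ≤ (N : ℝ) ^ α :=
      Real.one_le_rpow (by exact_mod_cast (by omega : 1 ≤ N)) hα
    have hcard' : (Set.ncard {n : ℕ | 1 ≤ n ∧ n ≤ N ∧
        ∃ m : ℤ, a n = (m : ℝ) * (N : ℝ) ^ (-α)} : ℝ) ≤ M + 1 := by exact_mod_cast hcard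
    linarith
  · obtain ⟨M, hcard, -, hM⟩ := h.card_bounds hN α
    have hN1 : (1 : ℝ) ≤ N := by exact_mod_cast (by omega : 1 ≤ N)
    set X : ℝ := (N : ℝ) ^ ((1 : ℝ) / 3 + α / 3) with hX
    have hX1 : 1 ≤ X := Real.one_le_rpow hN1 (by linarith)
    have hX3 : X ^ 3 = (N : ℝ) ^ (1 + α) := by
      rw [hX, ← Real.rpow_mul_natCast (by positivity)]
      congr 1
      push_cast
      ring
    have hMX : (M : ℝ) ≤ 7 * X := by
      refine le_of_pow_le_pow_left₀ (n := 3) (by norm_num) (by positivity) ?_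
      rw [mul_pow, hX3]
      have : (0 : ℝ) < (N : ℝ) ^ (1 + α) := by positivity
      linarith
    have hXε : X ≤ (N : ℝ) ^ ((1 : ℝ) / 3 + α / 3 + ε) :=
      Real.rpow_le_rpow_of_exponent_le hN1 (by linarith)
    have hcard' : (Set.ncard {n : ℕ | 1 ≤ n ∧ n ≤ N ∧
        ∃ m : ℤ, a n = (m : ℝ) * (N : ℝ) ^ (-α)} : ℝ) ≤ M + 1 := by exact_mod_cast hcard
    linarith
end
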